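/- Let K be an algebraically closed field of characteristic zero, let X be a smooth irreducible affine algebraic variety of dimension n > 0 with ring of differential operators D(X) = D(O(X)), and let Frac D(X) be the quotient division ring of D(X). Then every (commutative) subfield L of Frac D(X) that contains K satisfies tr.deg_K(L) ≤ n. -/

import Mathlib

/- Common definitions: degree of a function, standard finite-dimensional filtrations,
Gelfand-Kirillov dimension, return functions and filter dimensions (V. Bavula,
"Filter dimension"), and the Rentschler–Gabriel (left) Krull dimension via deviation. -/

open Filter

noncomputable section

/-- The degree `γ(f)` (as an extended real) of a function `f : ℕ → ℕ∞`:
`inf { r : ℝ | f i ≤ i ^ r for all sufficiently large i }` (`⊤` if no such `r` exists). -/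
def gammaDeg (f : ℕ → ℕ∞) : EReal :=
  sInf { x : EReal | ∃ r : ℝ, x = (r : EReal) ∧
    ∀ᶠ i in atTop, f i ≤ (⌊(i : ℝ) ^ r⌋₊ : ℕ∞) }

/-- `V` is the degree-one piece of a standard finite-dimensional filtration `{A_i = V ^ i}`
of the `K`-algebra `A`: it is finite-dimensional, contains `1` and generates `A`
(this is the filtration associated with a finite set of algebra generators). -/
structure IsStdFilt (K A : Type) [Field K] [Ring A] [Algebra K A] (V : Submodule K A) :
    Prop where
  one_mem : (1 : A) ∈ V
  fin : FiniteDimensional K V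
  gen : Algebra.adjoin K (V : Set A) = ⊤

/-- The Gelfand-Kirillov dimension `GK(A) = γ(i ↦ dim A_i)` of the algebra `A` w.r.t. the
standard filtration `{A_i = V ^ i}`. -/
def gkAlg (K A : Type) [Field K] [Ring A] [Algebra K A] (V : Submodule K A) : EReal :=
  gammaDeg fun i => (Module.finrank K (V ^ i : Submodule K A) : ℕ∞)

/-- The `K`-subspace `p • W` of the module `M` spanned by products `a • w`, `a ∈ p`, `w ∈ W`. -/
def smulSub (K : Type) [Field K] {A M : Type} [Ring A] [Algebra K A] [AddCommGroup M]
    [Module K M] [Module A M] [IsScalarTower K A M] (p : Submodule K A) (W : Submodule K M) :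
    Submodule K M :=
  Submodule.span K {x : M | ∃ a ∈ p, ∃ w ∈ W, x = a • w}

/-- `W` is a finite-dimensional generating subspace of the `A`-module `M`. -/
def IsGenSub (K A : Type) {M : Type} [Field K] [Ring A] [Algebra K A] [AddCommGroup M]
    [Module K M] [Module A M] [IsScalarTower K A M] (W : Submodule K M) : Prop :=
  FiniteDimensional K W ∧ Submodule.span A (W : Set M) = ⊤

/-- The Gelfand-Kirillov dimension `GK(M) = γ(i ↦ dim M_i)` of the module `M` w.r.t. the
standard filtration `{M_i = V ^ i • W}`. -/
def gkModW (K : Type) [Field K] {A M : Type} [Ring A] [Algebra K A] [AddCommGroup M]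
    [Module K M] [Module A M] [IsScalarTower K A M] (V : Submodule K A) (W : Submodule K M) :
    EReal :=
  gammaDeg fun i => (Module.finrank K (smulSub K (V ^ i) W) : ℕ∞)

/-- The Gelfand-Kirillov dimension of a module, as the infimum over all finite-dimensional
generating subspaces (it agrees with `gkModW` for each of them). -/
def gkMod (K A M : Type) [Field K] [Ring A] [Algebra K A] [AddCommGroup M] [Module K M]
    [Module A M] [IsScalarTower K A M] (V : Submodule K A) : EReal :=
  ⨅ W : {W : Submodule K M // IsGenSub K A W}, gkModW K V W.1

/-- The return function `ν_{F,W}` of the `A`-module `M` associated with the standard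
filtration `F = {V ^ i}` of `A` and the generating subspace `W` of `M`:
`ν(i) = min { j | V ^ j • N ⊇ W for every generating subspace N ⊆ V ^ i • W }`. -/
def retMod (K : Type) [Field K] {A M : Type} [Ring A] [Algebra K A] [AddCommGroup M]
    [Module K M] [Module A M] [IsScalarTower K A M] (V : Submodule K A) (W : Submodule K M)
    (i : ℕ) : ℕ∞ :=
  sInf { j : ℕ∞ | ∃ n : ℕ, j = (n : ℕ∞) ∧ ∀ N : Submodule K M,
      Submodule.span A (N : Set M) = ⊤ → N ≤ smulSub K (V ^ i) W →
      W ≤ smulSub K (V ^ n) N }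

/-- The filter dimension `fd(M) = γ(ν_{F,W})` of the `A`-module `M`. -/
def fdModW (K : Type) [Field K] {A M : Type} [Ring A] [Algebra K A] [AddCommGroup M]
    [Module K M] [Module A M] [IsScalarTower K A M] (V : Submodule K A) (W : Submodule K M) :
    EReal :=
  gammaDeg (retMod K V W)

/-- The return function `ν_F` of a (simple) algebra `A` w.r.t. the standard filtration
`F = {A_i = V ^ i}`: `ν_F(i) = min { j | 1 ∈ A_j a A_j for all 0 ≠ a ∈ A_i }`, where
`A_j a A_j` is the `K`-span of `{ x * a * y | x, y ∈ A_j }`. -/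
def nuFn (K : Type) [Field K] {A : Type} [Ring A] [Algebra K A] (V : Submodule K A)
    (i : ℕ) : ℕ∞ :=
  sInf { j : ℕ∞ | ∃ n : ℕ, j = (n : ℕ∞) ∧ ∀ a ∈ (V ^ i : Submodule K A), a ≠ 0 →
    (1 : A) ∈ Submodule.span K
      {x : A | ∃ u ∈ (V ^ n : Submodule K A), ∃ w ∈ (V ^ n : Submodule K A), x = u * a * w} }

/-- The left return function `λ_F` of a (simple) algebra `A`:
`λ_F(i) = min { j | 1 ∈ A a A_j for all 0 ≠ a ∈ A_i }`, where `A a A_j` is the left ideal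
of `A` generated by the set `a A_j`. -/
def lamFn (K : Type) [Field K] {A : Type} [Ring A] [Algebra K A] (V : Submodule K A)
    (i : ℕ) : ℕ∞ :=
  sInf { j : ℕ∞ | ∃ n : ℕ, j = (n : ℕ∞) ∧ ∀ a ∈ (V ^ i : Submodule K A), a ≠ 0 →
    (1 : A) ∈ Submodule.span A {x : A | ∃ w ∈ (V ^ n : Submodule K A), x = a * w} }

/-- The filter dimension `fd(A) = γ(ν_F)` of a simple finitely generated algebra `A`. -/
def fdAlg (K : Type) [Field K] {A : Type} [Ring A] [Algebra K A] (V : Submodule K A) : EReal :=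
  gammaDeg (nuFn K V)

/-- The left filter dimension `lfd(A) = γ(λ_F)` of a simple finitely generated algebra `A`. -/
def lfdAlg (K : Type) [Field K] {A : Type} [Ring A] [Algebra K A] (V : Submodule K A) : EReal :=
  gammaDeg (lamFn K V)

/-- `DevLE n α` : the deviation of the poset `α` is at most `n`. -/
def DevLE : ℕ → (α : Type) → [inst : Preorder α] → Prop
  | 0, α, _ => ∀ f : ℕ → α, Antitone f → ∀ᶠ i in atTop, ¬ f (i + 1) < f i
  | n + 1, α, _ => ∀ f : ℕ → α, Antitone f →
      ∀ᶠ i in atTop, DevLE n (Set.Icc (f (i + 1)) (f i))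

open Classical in
/-- The left Krull dimension in the sense of Rentschler–Gabriel of the `A`-module `M`:
the deviation of the poset of submodules of `M`, as an extended real (`⊥` for the zero
module, `⊤` if the deviation is not a natural number). For `M = A` this is the left Krull
dimension `K.dim A` of the ring `A`. -/
def kdimE (A M : Type) [Ring A] [AddCommGroup M] [Module A M] : EReal :=
  if Subsingleton M then ⊥
  else sInf { x : EReal | ∃ n : ℕ, x = (n : EReal) ∧ DevLE n (Submodule A M) }

/-- The order filtration `{D_i(B)}` on differential operators: `D_0(B) = End_B(B) ≅ B`
(multiplication operators) and `D_{i+1}(B) = { u ∈ End_K(B) | [u, r] ∈ D_i(B) ∀ r ∈ B }`. -/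
def diffOpsLE (K B : Type) [Field K] [CommRing B] [Algebra K B] :
    ℕ → Submodule K (Module.End K B)
  | 0 => LinearMap.range (Algebra.lmul K B).toLinearMap
  | n + 1 => ⨅ r : B, Submodule.comap
      (LinearMap.mulRight K ((Algebra.lmul K B) r) - LinearMap.mulLeft K ((Algebra.lmul K B) r))
      (diffOpsLE K B n)

/-- The ring `D(B) = ⋃_i D_i(B)` of `K`-linear differential operators on `B` (the union
is closed under the operations, so it coincides with the subalgebra it generates). -/
def diffOps (K B : Type) [Field K] [CommRing B] [Algebra K B] :
    Subalgebra K (Module.End K B) :=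
  Algebra.adjoin K (⋃ i, (diffOpsLE K B i : Set (Module.End K B)))

section

def dl (f : ℕ → ℤ) : ℕ → ℤ := fun i => f (i + 1) - f i

def VanAt (d : ℕ) (f : ℕ → ℤ) : Prop := ∀ᶠ i in atTop, dl^[d] f i = 0

lemma dl_sub (f g : ℕ → ℤ) : dl (f - g) = dl f - dl g := by
  funext i; simp [dl]; ring
lemma dl_add (f g : ℕ → ℤ) : dl (f + g) = dl f + dl g := by
  funext i; simp [dl]; ring
lemma dl_zero : dl 0 = 0 := by
  funext i; simp [dl]

lemma dl_iter_sub (d : ℕ) (f g : ℕ → ℤ) : dl^[d] (f - g) = dl^[d] f - dl^[d] g := by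
  induction d generalizing f g with
  | zero => rfl
  | succ d ih => simp only [Function.iterate_succ, Function.comp, dl_sub, ih]
lemma dl_iter_add (d : ℕ) (f g : ℕ → ℤ) : dl^[d] (f + g) = dl^[d] f + dl^[d] g := by
  induction d generalizing f g with
  | zero => rfl
  | succ d ih => simp only [Function.iterate_succ, Function.comp, dl_add, ih]

lemma dl_iter_shift (d c : ℕ) (f : ℕ → ℤ) (i : ℕ) :
    dl^[d] (fun i => f (i + c)) i = dl^[d] f (i + c) := by
  induction d generalizing f with
  | zero => rfl
  | succ d ih =>
    simp only [Function.iterate_succ, Function.comp]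
    rw [← ih]
    have : (dl fun i => f (i + c)) = fun i => dl f (i + c) := by
      funext j
      simp only [dl]
      rw [show j + 1 + c = j + c + 1 by ring]
    rw [this]

lemma VanAt.succ {d : ℕ} {f : ℕ → ℤ} (h : VanAt d f) : VanAt (d + 1) f := by
  unfold VanAt at *
  rw [Function.iterate_succ']
  have h2 := (tendsto_add_atTop_nat 1).eventually h
  filter_upwards [h, h2] with i h1 h2
  simp only [Function.comp]
  unfold dl at *
  simp_all

lemma VanAt.mono {d e : ℕ} {f : ℕ → ℤ} (h : VanAt d f) (hde : d ≤ e) : VanAt e f := by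
  induction hde with
  | refl => exact h
  | step _ ih => exact ih.succ

lemma VanAt.add {d : ℕ} {f g : ℕ → ℤ} (hf : VanAt d f) (hg : VanAt d g) : VanAt d (f + g) := by
  unfold VanAt at *
  filter_upwards [hf, hg] with i h1 h2
  simp [dl_iter_add, h1, h2]

lemma VanAt.shift {d : ℕ} {f : ℕ → ℤ} (c : ℕ) (hf : VanAt d f) :
    VanAt d (fun i => f (i + c)) := by
  unfold VanAt at *
  filter_upwards [(tendsto_add_atTop_nat c).eventually hf] with i h1
  rw [dl_iter_shift]; exact h1

lemma VanAt.unshift {d : ℕ} {f : ℕ → ℤ} (c : ℕ) (hf : VanAt d (fun i => f (i + c))) :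
    VanAt d f := by
  unfold VanAt at *
  simp only [dl_iter_shift] at hf
  rw [eventually_atTop] at *
  obtain ⟨a, ha⟩ := hf
  refine ⟨a + c, fun b hb => ?_⟩
  have := ha (b - c) (by omega)
  rwa [Nat.sub_add_cancel (by omega)] at this

lemma van_of_dl {d : ℕ} {f : ℕ → ℤ} (h : VanAt d (dl f)) : VanAt (d + 1) f := h

lemma van_pos (d : ℕ) (f : ℕ → ℤ) (hf : ∀ᶠ i in atTop, 0 ≤ f i) :
    ¬ ∀ᶠ i in atTop, dl^[d] f i ≤ -1 := by
  induction d with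
  | zero =>
    intro h
    obtain ⟨i, h1, h2⟩ := (hf.and h).exists
    simp at h2; omega
  | succ d ih =>
    intro h
    apply ih
    rw [Function.iterate_succ'] at h
    set F := dl^[d] f with hF
    rw [eventually_atTop] at *
    obtain ⟨a, ha⟩ := h
    have key : ∀ t : ℕ, F (a + t) ≤ F a - t := by
      intro t
      induction t with
      | zero => simp
      | succ t ih2 =>
        have := ha (a + t) (by omega)
        simp only [Function.comp, ← hF] at this
        unfold dl at this
        rw [← add_assoc]; push_cast; omega
    refine ⟨a + (F a).toNat + 1, fun b hb => ?_⟩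
    obtain ⟨t, rfl⟩ := Nat.exists_eq_add_of_le (show a ≤ b by omega)
    have := key t
    omega

lemma ev_const_of_dl {F : ℕ → ℤ} (h : ∀ᶠ i in atTop, dl F i = 0) :
    ∃ e, ∀ᶠ i in atTop, F i = e := by
  rw [eventually_atTop] at h
  obtain ⟨a, ha⟩ := h
  refine ⟨F a, ?_⟩
  rw [eventually_atTop]
  refine ⟨a, fun b hb => ?_⟩
  induction hb with
  | refl => rfl
  | step hb ih =>
    have := ha _ hb
    simp only [dl] at this
    simp only [Nat.succ_eq_add_one] at *
    omega

lemma van_const {d : ℕ} {f : ℕ → ℤ} (h : VanAt (d + 1) f) :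
    ∃ e, ∀ᶠ i in atTop, dl^[d] f i = e := by
  unfold VanAt at h
  rw [Function.iterate_succ'] at h
  exact ev_const_of_dl h

lemma van_cmp {d D : ℕ} {f g : ℕ → ℤ} (hf0 : ∀ᶠ i in atTop, 0 ≤ f i)
    (hfg : ∀ᶠ i in atTop, f i ≤ g i) (hf : VanAt D f) (hg : VanAt d g) : VanAt d f := by
  induction D with
  | zero => exact hf.mono (Nat.zero_le _)
  | succ D ih =>
    by_cases hD : D + 1 ≤ d
    · exact hf.mono hD
    apply ih
    obtain ⟨e, he⟩ := van_const hf
    have h0 : e = 0 := by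
      by_contra hne
      rcases lt_or_gt_of_ne hne with h | h
      · refine van_pos D f hf0 ?_
        filter_upwards [he] with i hi
        omega
      · refine van_pos D (g - f) ?_ ?_
        · filter_upwards [hfg] with i hi
          simpa using hi
        · have hg' : VanAt D g := hg.mono (by omega)
          filter_upwards [he, hg'] with i hi h2
          rw [dl_iter_sub]
          simp only [Pi.sub_apply, hi, h2]
          omega
    subst h0
    exact he

lemma van_bound {d : ℕ} {f : ℕ → ℤ} (h : VanAt (d + 1) f) :
    ∃ C : ℕ, ∀ i, |f i| ≤ C * ((i : ℤ) + 1) ^ d := by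
  induction d generalizing f with
  | zero =>
    obtain ⟨e, he⟩ := van_const h
    rw [eventually_atTop] at he
    obtain ⟨a, ha⟩ := he
    simp only [Function.iterate_zero, id] at ha
    refine ⟨∑ i ∈ Finset.range a, (|f i|).toNat + (|e|).toNat, fun i => ?_⟩
    simp only [pow_zero, mul_one]
    push_cast
    by_cases hi : i < a
    · have := Finset.single_le_sum (f := fun i => max |f i| 0) (s := Finset.range a)
        (fun j _ => le_max_right _ _) (Finset.mem_range.2 hi)
      have h3 : |f i| ≤ max |f i| 0 := le_max_left _ _
      have h4 : 0 ≤ max |e| 0 := le_max_right _ _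
      simp only [Int.ofNat_toNat] at *
      linarith
    · rw [ha i (by omega)]
      have : 0 ≤ ∑ i ∈ Finset.range a, max |f i| 0 :=
        Finset.sum_nonneg (fun j _ => le_max_right _ _)
      have h3 : |e| ≤ max |e| 0 := le_max_left _ _
      simp only [Int.ofNat_toNat] at *
      linarith
  | succ d ih =>
    obtain ⟨C, hC⟩ := ih (f := dl f) h
    refine ⟨C + (|f 0|).toNat, fun i => ?_⟩
    have key : ∀ i : ℕ, |f i| ≤ |f 0| + i * (C * ((i : ℤ) + 1) ^ d) := by
      intro i
      induction i with
      | zero => simp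
      | succ i ih2 =>
        have h1 := hC i
        have h2 : |f (i + 1)| ≤ |dl f i| + |f i| := by
          have : f (i + 1) = dl f i + f i := by simp [dl]
          rw [this]; exact abs_add_le _ _
        have h3 : (C : ℤ) * ((i : ℤ) + 1) ^ d ≤ C * (((i + 1 : ℕ) : ℤ) + 1) ^ d := by
          gcongr
          push_cast; omega
        have h4 : (i : ℤ) * (C * ((i : ℤ) + 1) ^ d) ≤ i * (C * (((i + 1 : ℕ) : ℤ) + 1) ^ d) := by
          gcongr
        have h5 : ((i + 1 : ℕ) : ℤ) * (C * (((i + 1 : ℕ) : ℤ) + 1) ^ d) = i * (C * (((i + 1 : ℕ) : ℤ) + 1) ^ d) + (C * (((i + 1 : ℕ) : ℤ) + 1) ^ d) := by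
          push_cast; ring
        linarith
    have h1 := key i
    have h2 : (|f 0|) ≤ ((|f 0|).toNat : ℤ) := Int.self_le_toNat _
    have h3 : (1 : ℤ) ≤ ((i : ℤ) + 1) ^ (d + 1) := one_le_pow₀ (by omega)
    have h4 : (i : ℤ) * (C * ((i : ℤ) + 1) ^ d) ≤ C * ((i : ℤ) + 1) ^ (d + 1) := by
      have : (C : ℤ) * ((i : ℤ) + 1) ^ (d + 1) = (i + 1) * (C * ((i : ℤ) + 1) ^ d) := by ring
      rw [this]
      have : 0 ≤ (C * ((i : ℤ) + 1) ^ d) := by positivity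
      nlinarith
    push_cast
    push_cast at h2
    have h5 : |f 0| ≤ max |f 0| 0 * ((i : ℤ) + 1) ^ (d + 1) := by
      have : 0 ≤ max |f 0| 0 := le_max_right _ _
      have h7 : |f 0| ≤ max |f 0| 0 := le_max_left _ _
      nlinarith
    simp only [Int.ofNat_toNat] at *
    linarith

lemma van_choose (N : ℕ) : VanAt (N + 1) (fun i => ((i + N).choose N : ℤ)) := by
  induction N with
  | zero =>
    refine Eventually.of_forall fun i => ?_
    simp [dl]
  | succ N ih =>
    apply van_of_dl
    have : dl (fun i => ((i + (N + 1)).choose (N + 1) : ℤ))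
        = fun i => (((i + 1) + N).choose N : ℤ) := by
      funext i
      simp only [dl]
      have : (i + 1 + (N + 1)).choose (N + 1) = (i + 1 + N).choose N + (i + (N + 1)).choose (N + 1) := by
        rw [show i + 1 + (N + 1) = (i + 1 + N) + 1 by ring, Nat.choose_succ_succ]
        congr 2; ring
      rw [this]; push_cast; ring
    rw [this]
    exact ih.shift 1

/-- count of exponents of total degree at most `i` outside of `U` -/
def HF {N : ℕ} (U : Set (Fin N → ℕ)) (i : ℕ) : ℕ :=
  Set.ncard {α : Fin N → ℕ | α ∉ U ∧ ∑ j, α j ≤ i}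

lemma finite_deg (N i : ℕ) : {α : Fin N → ℕ | ∑ j, α j ≤ i}.Finite := by
  refine (Set.finite_Iic (fun _ : Fin N => i)).subset ?_
  intro α hα j
  exact (Finset.single_le_sum (fun j _ => Nat.zero_le _) (Finset.mem_univ j)).trans hα

lemma HF_rec {N : ℕ} (U : Set (Fin (N + 1) → ℕ)) (i : ℕ) :
    HF U (i + 1) = HF {α : Fin N → ℕ | Fin.cons 0 α ∈ U} (i + 1)
      + HF {α : Fin (N + 1) → ℕ | Fin.cons (α 0 + 1) (Fin.tail α) ∈ U} i := by
  unfold HF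
  have e : {α : Fin (N + 1) → ℕ | α ∉ U ∧ ∑ j, α j ≤ i + 1} =
      (fun α : Fin N → ℕ => (Fin.cons 0 α : Fin (N + 1) → ℕ)) ''
        {α : Fin N → ℕ | α ∉ {α : Fin N → ℕ | Fin.cons 0 α ∈ U} ∧ ∑ j, α j ≤ i + 1} ∪
      (fun α : Fin (N + 1) → ℕ => (Fin.cons (α 0 + 1) (Fin.tail α) : Fin (N + 1) → ℕ)) ''
        {α | α ∉ {α : Fin (N + 1) → ℕ | Fin.cons (α 0 + 1) (Fin.tail α) ∈ U} ∧ ∑ j, α j ≤ i} := by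
    ext α
    simp only [Set.mem_ofPred_eq, Set.mem_union, Set.mem_image]
    constructor
    · rintro ⟨h1, h2⟩
      rw [Fin.sum_univ_succ] at h2
      rcases Nat.eq_zero_or_pos (α 0) with h0 | h0
      · left
        have : (Fin.cons 0 (Fin.tail α) : Fin (N + 1) → ℕ) = α := by
          rw [← h0]; exact Fin.cons_self_tail α
        refine ⟨Fin.tail α, ⟨by rwa [this], ?_⟩, this⟩
        simp only [Fin.tail]; omega
      · right
        have : (Fin.cons (α 0 - 1 + 1) (Fin.tail α) : Fin (N + 1) → ℕ) = α := by
          rw [Nat.sub_add_cancel h0]; exact Fin.cons_self_tail α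
        refine ⟨Fin.cons (α 0 - 1) (Fin.tail α), ⟨by simpa [this] using h1, ?_⟩, by simpa using this⟩
        rw [Fin.sum_univ_succ]
        simp only [Fin.cons_zero, Fin.cons_succ, Fin.tail]; omega
    · rintro (⟨β, ⟨h1, h2⟩, rfl⟩ | ⟨β, ⟨h1, h2⟩, rfl⟩)
      · refine ⟨h1, ?_⟩
        rw [Fin.sum_univ_succ]; simpa using h2
      · refine ⟨h1, ?_⟩
        rw [Fin.sum_univ_succ] at *
        simp only [Fin.cons_zero, Fin.cons_succ, Fin.tail]; omega
  have fin1 := ((finite_deg N (i + 1)).subset (t := {α : Fin N → ℕ | α ∉ {α : Fin N → ℕ | Fin.cons 0 α ∈ U} ∧ ∑ j, α j ≤ i + 1}) (fun _ h => h.2)).image (fun α : Fin N → ℕ => (Fin.cons 0 α : Fin (N + 1) → ℕ))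
  have fin2 := ((finite_deg (N + 1) i).subset (t := {α | α ∉ {α : Fin (N + 1) → ℕ | Fin.cons (α 0 + 1) (Fin.tail α) ∈ U} ∧ ∑ j, α j ≤ i}) (fun _ h => h.2)).image (fun α : Fin (N + 1) → ℕ => (Fin.cons (α 0 + 1) (Fin.tail α) : Fin (N + 1) → ℕ))
  rw [e, Set.ncard_union_eq ?_ fin1 fin2, Set.ncard_image_of_injective, Set.ncard_image_of_injective]
  · intro a b h
    have h0 := congrFun h 0
    simp at h0
    funext j
    refine Fin.cases h0 (fun j => ?_) j
    have := congrFun h j.succ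
    simpa [Fin.tail] using this
  · intro a b h
    funext j
    have := congrFun h j.succ
    simpa using this
  · rw [Set.disjoint_left]
    rintro _ ⟨a, _, rfl⟩ ⟨b, _, h⟩
    have := congrFun h 0
    simp at this

lemma HF_empty (N i : ℕ) : HF (∅ : Set (Fin N → ℕ)) i = (i + N).choose N := by
  induction N generalizing i with
  | zero =>
    unfold HF
    simp only [Nat.choose_zero_right]
    rw [Set.ncard_eq_one]
    refine ⟨0, ?_⟩
    ext α; simp [Subsingleton.elim α 0]
  | succ N ihN =>
    induction i with
    | zero =>
      unfold HF
      simp only [zero_add, Nat.choose_self]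
      rw [Set.ncard_eq_one]
      refine ⟨0, ?_⟩
      ext α; simp [funext_iff]
    | succ i ih =>
      rw [HF_rec]
      simp only [Set.mem_empty_iff_false, Set.ofPred_false]
      rw [ihN, ih, show i + 1 + (N + 1) = (i + 1 + N) + 1 by ring, Nat.choose_succ_succ]
      congr 2; ring

lemma wf_upper (N : ℕ) : WellFounded (fun U V : {U : Set (Fin N → ℕ) // IsUpperSet U} => V.1 ⊂ U.1) := by
  rw [wellFounded_iff_isEmpty_descending_chain]
  constructor
  rintro ⟨f, hf⟩
  have hmono : ∀ a b, a ≤ b → (f a).1 ⊆ (f b).1 := by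
    intro a b h
    induction h with
    | refl => exact subset_rfl
    | step _ ih => exact ih.trans (hf _).subset
  choose x hx hx' using fun i => Set.exists_of_ssubset (hf i)
  have := wellQuasiOrdered_le (α := Fin N → ℕ)
  obtain ⟨a, b, hab, hle⟩ := this x
  exact hx' b (hmono _ _ hab ((f (a+1)).2 hle (hx a)))

lemma HF_van (N : ℕ) (U : Set (Fin N → ℕ)) (hU : IsUpperSet U) :
    ∃ d, VanAt d (fun i => (HF U i : ℤ)) := by
  induction N with
  | zero =>
    refine ⟨1, Eventually.of_forall fun i => ?_⟩
    simp [dl, HF]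
  | succ N ihN =>
    suffices H : ∀ U : {U : Set (Fin (N + 1) → ℕ) // IsUpperSet U},
      ∃ d, VanAt d (fun i => (HF U.1 i : ℤ)) from H ⟨U, hU⟩
    intro U
    induction U using (wf_upper (N + 1)).induction with
    | _ U ih =>
    obtain ⟨U, hU⟩ := U
    obtain ⟨d, hd⟩ := ihN {α : Fin N → ℕ | Fin.cons 0 α ∈ U} (by
      intro a b hab ha
      refine hU ?_ ha
      intro j
      refine Fin.cases (by simp) (fun j => ?_) j
      simpa using hab j)
    set W := {α : Fin (N + 1) → ℕ | Fin.cons (α 0 + 1) (Fin.tail α) ∈ U} with hWdef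
    have hW : IsUpperSet W := by
      intro a b hab ha
      refine hU ?_ ha
      intro j
      refine Fin.cases (by simpa using hab 0) (fun j => ?_) j
      simpa [Fin.tail] using hab j.succ
    have hUW : U ⊆ W := by
      intro a ha
      refine hU ?_ ha
      intro j
      refine Fin.cases (by simp) (fun j => ?_) j
      simp [Fin.tail]
    have hrec := HF_rec U
    by_cases hEq : U = W
    · refine ⟨d + 1, van_of_dl ?_⟩
      have : dl (fun i => (HF U i : ℤ)) = fun i => (HF {α : Fin N → ℕ | Fin.cons 0 α ∈ U} (i + 1) : ℤ) := by
        funext i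
        simp only [dl]
        rw [hrec, ← hWdef, ← hEq]; push_cast; ring
      rw [this]
      exact hd.shift 1
    · obtain ⟨d', hd'⟩ := ih ⟨W, hW⟩ (hUW.ssubset_of_ne hEq)
      refine ⟨max d d', VanAt.unshift 1 ?_⟩
      have : (fun i => (HF U (i + 1) : ℤ)) = (fun i => (HF {α : Fin N → ℕ | Fin.cons 0 α ∈ U} (i + 1) : ℤ)) + fun i => (HF W i : ℤ) := by
        funext i
        rw [hrec]; simp [hWdef]
      rw [this]
      exact ((hd.shift 1).mono (le_max_left _ _)).add (hd'.mono (le_max_right _ _))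
end

section

section words
variable {A : Type*} [Ring A] {N : ℕ} (Z : Fin N → A)

def opw (w : List (Fin N)) : A := (w.map Z).prod

lemma opw_nil : opw Z [] = 1 := rfl
lemma opw_cons (a : Fin N) (w : List (Fin N)) : opw Z (a :: w) = Z a * opw Z w := by
  simp [opw]
lemma opw_append (u w : List (Fin N)) : opw Z (u ++ w) = opw Z u * opw Z w := by
  simp [opw]

def wd (α : Fin N → ℕ) : List (Fin N) :=
  (List.finRange N).flatMap (fun a => List.replicate (α a) a)

lemma count_wd (α : Fin N → ℕ) (b : Fin N) : (wd α).count b = α b := by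
  unfold wd
  rw [List.count_flatMap, ← List.ofFn_eq_map, List.sum_ofFn]
  rw [Finset.sum_eq_single b]
  · simp
  · intro a _ hab
    simp [List.count_replicate, hab]
  · simp

lemma length_eq_sum_count (w : List (Fin N)) : w.length = ∑ a, w.count a := by
  induction w with
  | nil => simp
  | cons a w ih =>
    simp [List.count_cons, Finset.sum_add_distrib, ih]

lemma length_wd (α : Fin N → ℕ) : (wd α).length = ∑ a, α a := by
  rw [length_eq_sum_count]; simp [count_wd]

def mn (α : Fin N → ℕ) : A := opw Z (wd α)

/-- span of the words of length `< i` -/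
def Wlt (i : ℕ) : AddSubgroup A := AddSubgroup.closure {x | ∃ w : List (Fin N), w.length < i ∧ x = opw Z w}
def Mlt (i : ℕ) : AddSubgroup A :=
  AddSubgroup.closure {x | ∃ α : Fin N → ℕ, ∑ a, α a < i ∧ x = mn Z α}

lemma opw_mem_Wlt {i : ℕ} {w : List (Fin N)} (h : w.length < i) : opw Z w ∈ Wlt Z i :=
  AddSubgroup.subset_closure ⟨w, h, rfl⟩
lemma mn_mem_Mlt {i : ℕ} {α : Fin N → ℕ} (h : ∑ a, α a < i) : mn Z α ∈ Mlt Z i :=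
  AddSubgroup.subset_closure ⟨α, h, rfl⟩

lemma Wlt_mono {i j : ℕ} (h : i ≤ j) : Wlt Z i ≤ Wlt Z j := by
  apply AddSubgroup.closure_mono
  rintro x ⟨w, hw, rfl⟩; exact ⟨w, by omega, rfl⟩
lemma Mlt_mono {i j : ℕ} (h : i ≤ j) : Mlt Z i ≤ Mlt Z j := by
  apply AddSubgroup.closure_mono
  rintro x ⟨w, hw, rfl⟩; exact ⟨w, by omega, rfl⟩

lemma mul_mem_Wlt {i : ℕ} {x : A} (a : Fin N) (h : x ∈ Wlt Z i) : Z a * x ∈ Wlt Z (i + 1) := by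
  have : Wlt Z i ≤ (Wlt Z (i + 1)).comap (AddMonoidHom.mulLeft (Z a)) := by
    unfold Wlt
    rw [AddSubgroup.closure_le]
    rintro x ⟨w, hw, rfl⟩
    exact AddSubgroup.subset_closure ⟨a :: w, by simpa using hw, (opw_cons Z a w).symm⟩
  exact this h

variable {Z}

lemma perm_sub (hZ : ∀ a b, ∃ c : ℤ, Z a * Z b - Z b * Z a = c) {w w' : List (Fin N)}
    (h : w.Perm w') : opw Z w - opw Z w' ∈ Wlt Z w.length := by
  induction h with
  | nil => simp
  | cons a h ih =>
    rw [opw_cons, opw_cons, ← mul_sub]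
    exact mul_mem_Wlt Z a ih
  | swap a b l =>
    obtain ⟨c, hc⟩ := hZ b a
    have : opw Z (b :: a :: l) - opw Z (a :: b :: l) = c • opw Z l := by
      simp only [opw_cons, ← mul_assoc, ← sub_mul]
      rw [hc]; simp
    rw [this]
    apply AddSubgroup.zsmul_mem
    apply opw_mem_Wlt; simp
  | trans h1 h2 ih1 ih2 =>
    have := AddSubgroup.add_mem _ ih1 (h1.length_eq ▸ ih2)
    simpa using this

lemma opw_sub_mn (hZ : ∀ a b, ∃ c : ℤ, Z a * Z b - Z b * Z a = c) (w : List (Fin N)) :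
    opw Z w - mn Z (fun a => w.count a) ∈ Wlt Z w.length := by
  apply perm_sub hZ
  rw [List.perm_iff_count]
  intro a; rw [count_wd]

lemma Wlt_le_Mlt (hZ : ∀ a b, ∃ c : ℤ, Z a * Z b - Z b * Z a = c) (i : ℕ) :
    Wlt Z i ≤ Mlt Z i := by
  induction i with
  | zero => unfold Wlt; rw [AddSubgroup.closure_le]; rintro x ⟨w, hw, rfl⟩; omega
  | succ i ih =>
    unfold Wlt; rw [AddSubgroup.closure_le]; rintro x ⟨w, hw, rfl⟩
    have h1 := (Wlt_mono Z (show w.length ≤ i by omega)) (opw_sub_mn hZ w)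
    have h2 := Mlt_mono Z (show i ≤ i + 1 by omega) (ih h1)
    have h3 : mn Z (fun a => w.count a) ∈ Mlt Z (i + 1) := by
      apply mn_mem_Mlt; rw [← length_eq_sum_count]; exact hw
    have := AddSubgroup.add_mem _ h2 h3
    simpa using this

lemma mul_mn (hZ : ∀ a b, ∃ c : ℤ, Z a * Z b - Z b * Z a = c) (a : Fin N) (α : Fin N → ℕ) :
    Z a * mn Z α - mn Z (α + Pi.single a 1) ∈ Mlt Z (∑ b, α b + 1) := by
  have h := Wlt_le_Mlt hZ _ (opw_sub_mn hZ (a :: wd α))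
  rw [List.length_cons, length_wd, opw_cons] at h
  convert h using 3
  congr 1
  funext b
  rw [List.count_cons, count_wd, Pi.add_apply, Pi.single_apply]
  by_cases h : a = b <;> simp [h, eq_comm (a := b)]

end words

section count
variable {k V ι O : Type*} [Field k] [AddCommGroup V] [Module k V] [LinearOrder O]

open Classical in
lemma count_basis (key : ι → O) (hk : Function.Injective key) (w : ι → V) (S : Finset ι)
    (hS : ∀ s ∈ S, ∀ t, key t < key s → t ∈ S) :
    Module.finrank k (Submodule.span k (w '' S)) =
      (S.filter (fun s => w s ∉ Submodule.span k (w '' {t | key t < key s}))).card := by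
  induction hn : S.card generalizing S with
  | zero =>
    rw [Finset.card_eq_zero] at hn; subst hn
    rw [Finset.coe_empty, Set.image_empty, Submodule.span_empty, finrank_bot]; rfl
  | succ m ih =>
    have hne : S.Nonempty := by rw [← Finset.card_pos]; omega
    obtain ⟨s, hs, hmax⟩ := Finset.exists_max_image S key hne
    have hT : ((S.erase s : Finset ι) : Set ι) = {t | key t < key s} := by
      ext t
      simp only [Finset.coe_erase, Set.mem_sdiff, Finset.mem_coe, Set.mem_singleton_iff]
      constructor
      · rintro ⟨h1, h2⟩
        exact lt_of_le_of_ne (hmax t h1) (fun h => h2 (hk h))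
      · intro h
        exact ⟨hS s hs t h, fun h' => by subst h'; exact lt_irrefl _ h⟩
    have ih' := ih (S.erase s) (by
      intro u hu t ht
      have hu' := Finset.mem_of_mem_erase hu
      have : t ∈ ((S.erase s : Finset ι) : Set ι) := by
        rw [hT]; exact lt_of_lt_of_le ht (hmax u hu')
      exact this) (by rw [Finset.card_erase_of_mem hs]; omega)
    have hSi : S = insert s (S.erase s) := (Finset.insert_erase hs).symm
    have hSi' : (S : Set ι) = insert s ((S.erase s : Finset ι) : Set ι) := by
      rw [← Finset.coe_insert, ← hSi]
    have hf : S.filter (fun s => w s ∉ Submodule.span k (w '' {t | key t < key s})) =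
       (insert s (S.erase s)).filter (fun s => w s ∉ Submodule.span k (w '' {t | key t < key s})) := by
      rw [← hSi]
    rw [hf, Finset.filter_insert, hSi', Set.image_insert_eq]
    have fd : FiniteDimensional k (Submodule.span k (w '' ((S.erase s : Finset ι) : Set ι))) :=
      FiniteDimensional.span_of_finite k ((Finset.finite_toSet _).image _)
    by_cases hw : w s ∈ Submodule.span k (w '' {t | key t < key s})
    · rw [if_neg (by simpa using hw), ← ih']
      rw [← hT] at hw
      rw [Submodule.span_insert_eq_span hw]
    · rw [if_pos hw, Finset.card_insert_of_notMem (by simp), ← ih']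
      rw [← hT] at hw
      rw [Submodule.span_insert, add_comm, sup_comm]
      have hw0 : w s ≠ 0 := fun h => hw (h ▸ Submodule.zero_mem _)
      have := Submodule.finrank_sup_add_finrank_inf_eq (Submodule.span k (w '' ((S.erase s : Finset ι) : Set ι))) (Submodule.span k {w s})
      have hd : Submodule.span k (w '' ((S.erase s : Finset ι) : Set ι)) ⊓ Submodule.span k {w s} = ⊥ := by
        rw [← disjoint_iff]
        exact (Submodule.disjoint_span_singleton' hw0).2 hw
      rw [hd, finrank_bot, finrank_span_singleton hw0] at this
      omega
end count

section hilb
variable {A V : Type*} [Ring A] [AddCommGroup V] [Module A V] {N : ℕ} (Z : Fin N → A)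

def Mf (k : Type*) [Field k] [Module k V] {r : ℕ} (v : Fin r → V) (i : ℕ) : Submodule k V :=
  Submodule.span k {x | ∃ w : List (Fin N), w.length ≤ i ∧ ∃ j, x = opw Z w • v j}

def hf (k : Type*) [Field k] [Module k V] {r : ℕ} (v : Fin r → V) (i : ℕ) : ℤ :=
  (Module.finrank k (Mf Z k v i) : ℤ)

variable {k : Type*} [Field k] [Module k V] [SMulCommClass A k V] {r : ℕ} (v : Fin r → V)

lemma finite_words (N i : ℕ) : {w : List (Fin N) | w.length ≤ i}.Finite :=
  List.finite_length_le (Fin N) i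

instance Mf_fd (i : ℕ) : FiniteDimensional k (Mf Z k v i) := by
  apply FiniteDimensional.span_of_finite
  refine (((finite_words N i).prod (Set.finite_univ (α := Fin r))).image
    (fun p => opw Z p.1 • v p.2)).subset ?_
  rintro x ⟨w, hw, j, rfl⟩
  exact ⟨(w, j), ⟨hw, trivial⟩, rfl⟩

lemma Mlt_smul_mem {i : ℕ} {x : A} (hx : x ∈ Mlt Z i) (W : Submodule k V) (y : V)
    (h : ∀ α : Fin N → ℕ, ∑ a, α a < i → mn Z α • y ∈ W) : x • y ∈ W := by
  unfold Mlt at hx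
  induction hx using AddSubgroup.closure_induction with
  | mem x hx => obtain ⟨α, hα, rfl⟩ := hx; exact h α hα
  | zero => simp
  | add x y _ _ h1 h2 => rw [add_smul]; exact W.add_mem h1 h2
  | neg x _ h1 => rw [neg_smul]; exact W.neg_mem h1

lemma Mf_eq_mn (hZ : ∀ a b, ∃ c : ℤ, Z a * Z b - Z b * Z a = c) (i : ℕ) :
    Mf Z k v i = Submodule.span k ((fun p : (Fin N → ℕ) × Fin r => mn Z p.1 • v p.2) ''
      {p | ∑ a, p.1 a ≤ i}) := by
  apply le_antisymm
  · apply Submodule.span_le.2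
    rintro x ⟨w, hw, j, rfl⟩
    apply Mlt_smul_mem Z (i := i + 1) (Wlt_le_Mlt hZ _ (opw_mem_Wlt Z (Nat.lt_succ_of_le hw)))
    intro α hα
    exact Submodule.subset_span ⟨(α, j), Nat.le_of_lt_succ hα, rfl⟩
  · apply Submodule.span_mono
    rintro x ⟨⟨α, j⟩, h, rfl⟩
    exact ⟨wd α, by rw [length_wd]; exact h, j, rfl⟩

def keyI (p : (Fin N → ℕ) × Fin r) : ℕ ×ₗ (Lex (Fin N → ℕ) ×ₗ Fin r) :=
  toLex (∑ a, p.1 a, toLex (toLex p.1, p.2))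

lemma keyI_inj : Function.Injective (keyI (N := N) (r := r)) := by
  rintro ⟨a, b⟩ ⟨c, d⟩ h
  simp only [keyI] at h
  have h1 := toLex.injective h
  have h2 := toLex.injective (Prod.ext_iff.1 h1).2
  have h3 := Prod.ext_iff.1 h2
  exact Prod.ext (toLex.injective h3.1) h3.2

lemma keyI_lt (p q : (Fin N → ℕ) × Fin r) : keyI p < keyI q ↔
    ∑ a, p.1 a < ∑ a, q.1 a ∨ (∑ a, p.1 a = ∑ a, q.1 a ∧ (toLex p.1 < toLex q.1 ∨
      (p.1 = q.1 ∧ p.2 < q.2))) := by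
  simp only [keyI, Prod.Lex.toLex_lt_toLex]
  simp

lemma sum_single (α : Fin N → ℕ) (a : Fin N) :
    ∑ b, (α + Pi.single a 1 : Fin N → ℕ) b = ∑ b, α b + 1 := by
  simp [Finset.sum_add_distrib]

lemma keyI_add (p q : (Fin N → ℕ) × Fin r) (a : Fin N) (h : keyI p < keyI q) :
    keyI (p.1 + Pi.single a 1, p.2) < keyI (q.1 + Pi.single a 1, q.2) := by
  rw [keyI_lt] at h ⊢
  simp only [sum_single]
  rcases h with h | ⟨h1, h | ⟨h2, h3⟩⟩
  · left; omega
  · right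
    refine ⟨by omega, Or.inl ?_⟩
    rw [toLex_add, toLex_add]
    exact add_lt_add_left h _
  · right; exact ⟨by omega, Or.inr ⟨by rw [h2], h3⟩⟩

variable (k) in
def Ups (j : Fin r) : Set (Fin N → ℕ) :=
  {α | mn Z α • v j ∈ Submodule.span k ((fun p : (Fin N → ℕ) × Fin r => mn Z p.1 • v p.2) ''
    {p | keyI p < keyI (α, j)})}

lemma Ups_step (hZ : ∀ a b, ∃ c : ℤ, Z a * Z b - Z b * Z a = c) (j : Fin r) (α : Fin N → ℕ)
    (a : Fin N) (h : α ∈ Ups Z k v j) : α + Pi.single a 1 ∈ Ups Z k v j := by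
  change _ ∈ Submodule.span _ _ at h
  change _ ∈ Submodule.span _ _
  set W := Submodule.span k ((fun p : (Fin N → ℕ) × Fin r => mn Z p.1 • v p.2) ''
    {p | keyI p < keyI (α + Pi.single a 1, j)}) with hW
  have key : ∀ β l, ∑ b, β b ≤ ∑ b, α b → (Z a * mn Z β - mn Z (β + Pi.single a 1)) • v l ∈ W := by
    intro β l hβ
    apply Mlt_smul_mem Z (mul_mn hZ a β)
    intro γ hγ
    refine Submodule.subset_span ⟨(γ, l), ?_, rfl⟩
    change keyI _ < keyI _
    rw [keyI_lt]; left
    simp only [sum_single]; omega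
  have h1 : Z a • (mn Z α • v j) ∈ W := by
    have : Submodule.span k ((fun p : (Fin N → ℕ) × Fin r => mn Z p.1 • v p.2) ''
      {p | keyI p < keyI (α, j)}) ≤ W.comap (DistribSMul.toLinearMap k V (Z a)) := by
      rw [Submodule.span_le]
      rintro _ ⟨⟨β, l⟩, hp, rfl⟩
      change Z a • (mn Z β • v l) ∈ W
      have hp' : keyI (β, l) < keyI (α, j) := hp
      have h2 := key β l (by rw [keyI_lt] at hp'; simp only at hp'; omega)
      have h3 : mn Z (β + Pi.single a 1) • v l ∈ W :=
        Submodule.subset_span ⟨(β + Pi.single a 1, l), keyI_add _ _ a hp', rfl⟩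
      have := W.add_mem h2 h3
      rw [← add_smul, sub_add_cancel, mul_smul] at this
      exact this
    exact this h
  have := W.sub_mem h1 (key α j le_rfl)
  rw [← mul_smul, ← sub_smul, sub_sub_cancel] at this
  exact this

lemma Ups_upper (hZ : ∀ a b, ∃ c : ℤ, Z a * Z b - Z b * Z a = c) (j : Fin r) :
    IsUpperSet (Ups Z k v j) := by
  have : ∀ m, ∀ α β : Fin N → ℕ, α ≤ β → ∑ a, (β a - α a) = m → α ∈ Ups Z k v j → β ∈ Ups Z k v j := by
    intro m
    induction m with
    | zero =>
      intro α β h hs hα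
      rw [Finset.sum_eq_zero_iff] at hs
      have : α = β := by
        funext a
        have := hs a (Finset.mem_univ a)
        have : α a ≤ β a := h a
        omega
      rwa [← this]
    | succ m ih =>
      intro α β h hs hα
      have : ∃ a ∈ Finset.univ, β a - α a ≠ 0 := by
        apply Finset.exists_ne_zero_of_sum_ne_zero; omega
      obtain ⟨a, -, ha⟩ := this
      refine ih (α + Pi.single a 1) β ?_ ?_ (Ups_step Z v hZ j α a hα)
      · intro b
        by_cases hb : b = a
        · subst hb; simp; omega
        · simp [hb, h b]
      · have h2 : ∀ b, β b - α b = (β b - (α + Pi.single a 1 : Fin N → ℕ) b) + (Pi.single a 1 : Fin N → ℕ) b := by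
          intro b
          by_cases hb : b = a
          · subst hb; simp; omega
          · simp [hb]
        rw [Finset.sum_congr rfl (fun b _ => h2 b), Finset.sum_add_distrib] at hs
        simpa using hs
  intro α β h hα
  exact this _ α β h rfl hα

lemma hf_eq (hZ : ∀ a b, ∃ c : ℤ, Z a * Z b - Z b * Z a = c) (i : ℕ) :
    hf Z k v i = ∑ j, (HF (Ups Z k v j) i : ℤ) := by
  classical
  unfold hf
  rw [Mf_eq_mn Z v hZ]
  have hfin : {p : (Fin N → ℕ) × Fin r | ∑ a, p.1 a ≤ i}.Finite := by
    refine ((finite_deg N i).prod (Set.finite_univ (α := Fin r))).subset ?_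
    rintro ⟨α, j⟩ h; exact ⟨h, trivial⟩
  have := count_basis (k := k) keyI keyI_inj (fun p : (Fin N → ℕ) × Fin r => mn Z p.1 • v p.2)
    hfin.toFinset (by
      intro s hs t ht
      rw [keyI_lt] at ht
      simp only [Set.Finite.mem_toFinset, Set.mem_ofPred_eq] at hs ⊢
      omega)
  rw [Set.Finite.coe_toFinset] at this
  rw [this]
  rw [Finset.card_eq_sum_card_fiberwise (f := fun p => p.2) (t := Finset.univ) (by intro x _; simp)]
  push_cast
  apply Finset.sum_congr rfl
  intro j _
  unfold HF
  rw [Set.ncard_eq_toFinset_card _ ((finite_deg N i).subset (fun _ h => h.2))]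
  norm_cast
  apply Finset.card_bij (fun p _ => p.1)
  · rintro ⟨α, l⟩ h
    simp only [Finset.mem_filter, Set.Finite.mem_toFinset, Set.mem_ofPred_eq] at h ⊢
    obtain ⟨⟨h1, h2⟩, rfl⟩ := h
    exact ⟨h2, h1⟩
  · rintro ⟨α, l⟩ h ⟨β, l'⟩ h' e
    simp only [Finset.mem_filter] at h h'
    exact Prod.ext e (h.2.trans h'.2.symm)
  · intro α hα
    simp only [Finset.mem_filter, Set.Finite.mem_toFinset, Set.mem_ofPred_eq] at hα ⊢
    exact ⟨(α, j), ⟨⟨hα.2, hα.1⟩, rfl⟩, rfl⟩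

lemma VanAt.sum {ι : Type*} (s : Finset ι) (f : ι → ℕ → ℤ) (d : ℕ) (h : ∀ j ∈ s, VanAt d (f j)) :
    VanAt d (fun i => ∑ j ∈ s, f j i) := by
  classical
  induction s using Finset.induction_on with
  | empty =>
    have : VanAt 0 (fun _ : ℕ => (0:ℤ)) := by simp [VanAt]
    simpa using this.mono (Nat.zero_le d)
  | insert a s ha ih =>
    have h1 := h a (Finset.mem_insert_self _ _)
    have h2 := ih (fun j hj => h j (Finset.mem_insert_of_mem hj))
    have := h1.add h2
    convert this using 1
    funext i
    simp [Finset.sum_insert ha]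

lemma hf_van (hZ : ∀ a b, ∃ c : ℤ, Z a * Z b - Z b * Z a = c) : ∃ d, VanAt d (hf Z k v) := by
  have : ∀ j, ∃ d, VanAt d (fun i => (HF (Ups Z k v j) i : ℤ)) := fun j =>
    HF_van N _ (Ups_upper Z v hZ j)
  choose d hd using this
  refine ⟨∑ j, d j, ?_⟩
  have e : hf Z k v = fun i => ∑ j, (HF (Ups Z k v j) i : ℤ) := funext (hf_eq Z v hZ)
  rw [e]
  apply VanAt.sum
  intro j hj
  exact (hd j).mono (Finset.single_le_sum (f := d) (fun _ _ => Nat.zero_le _) hj)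

lemma hf_le (hZ : ∀ a b, ∃ c : ℤ, Z a * Z b - Z b * Z a = c) (i : ℕ) :
    hf Z k v i ≤ r * ((i + N).choose N : ℤ) := by
  rw [hf_eq Z v hZ]
  calc ∑ j, (HF (Ups Z k v j) i : ℤ) ≤ ∑ _j : Fin r, ((i + N).choose N : ℤ) := by
        apply Finset.sum_le_sum
        intro j _
        rw [← HF_empty]
        norm_cast
        unfold HF
        apply Set.ncard_le_ncard
        · rintro α ⟨h1, h2⟩; exact ⟨by simp, h2⟩
        · exact (finite_deg N i).subset (fun _ h => h.2)
    _ = _ := by simp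

lemma hf_van_N (hZ : ∀ a b, ∃ c : ℤ, Z a * Z b - Z b * Z a = c) : VanAt (N + 1) (hf Z k v) := by
  obtain ⟨d, hd⟩ := hf_van Z v hZ (k := k)
  refine van_cmp (g := fun i => ∑ _j : Fin r, ((i + N).choose N : ℤ)) ?_ ?_ hd
    (VanAt.sum _ _ _ (fun j _ => van_choose N))
  · exact Filter.Eventually.of_forall (fun i => by unfold hf; positivity)
  · exact Filter.Eventually.of_forall (fun i => by simpa using hf_le Z v hZ i)
end hilb
end

section

section bern
variable {A V : Type*} [Ring A] [AddCommGroup V] [Module A V] {N : ℕ} {Z : Fin N → A}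

lemma opw_flatMap (l : List (Fin N)) (α : Fin N → ℕ) :
    opw Z (l.flatMap (fun a => List.replicate (α a) a)) = (l.map (fun b => Z b ^ α b)).prod := by
  induction l with
  | nil => simp [opw]
  | cons a l ih => rw [List.flatMap_cons, opw_append, ih]; simp [opw]

lemma comm_pow {X z : A} {ε : ℤ} (h : X * z - z * X = ε) (m : ℕ) :
    X * z ^ (m + 1) - z ^ (m + 1) * X = ((ε * (m + 1) : ℤ) : A) * z ^ m := by
  induction m with
  | zero => simpa using h
  | succ m ih =>
    have e : X * z ^ (m + 1 + 1) - z ^ (m + 1 + 1) * X =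
      (X * z ^ (m + 1) - z ^ (m + 1) * X) * z + z ^ (m + 1) * (X * z - z * X) := by
      rw [pow_succ z (m + 1)]; noncomm_ring
    rw [e, ih, h, ← Int.cast_comm, mul_assoc, ← pow_succ, ← add_mul]
    congr 1
    rw [← Int.cast_add]
    congr 1
    push_cast
    ring

lemma comm_pow0 {X z : A} (h : X * z - z * X = 0) (m : ℕ) :
    X * z ^ m - z ^ m * X = 0 := by
  rw [sub_eq_zero] at *
  exact (Commute.pow_right h m)

lemma comm_prod0 {X : A} {a : Fin N} {ε : ℤ}
    (h : ∀ b, X * Z b - Z b * X = if b = a then (ε : A) else 0) (l : List (Fin N))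
    (α : Fin N → ℕ) (hα : a ∉ l ∨ α a = 0) :
    X * (l.map (fun b => Z b ^ α b)).prod - (l.map (fun b => Z b ^ α b)).prod * X = 0 := by
  induction l with
  | nil => simp
  | cons b l ih =>
    have ih := ih (by rcases hα with h | h; exact Or.inl (fun h' => h (List.mem_cons_of_mem _ h')); exact Or.inr h)
    rw [List.map_cons, List.prod_cons]
    have h1 : X * Z b ^ α b - Z b ^ α b * X = 0 := by
      by_cases hb : b = a
      · have : α b = 0 := by
          rcases hα with h | h
          · exact absurd (by simp [hb]) h
          · rwa [hb]
        rw [this]; simp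
      · apply comm_pow0; rw [h, if_neg hb]
    rw [sub_eq_zero] at *
    rw [← mul_assoc, h1, mul_assoc, ih, mul_assoc]

lemma comm_prod1 {X : A} {a : Fin N} {ε : ℤ}
    (h : ∀ b, X * Z b - Z b * X = if b = a then (ε : A) else 0) (l : List (Fin N)) (hl : l.Nodup)
    (ha : a ∈ l) (β : Fin N → ℕ) :
    X * (l.map (fun b => Z b ^ (β + Pi.single a 1 : Fin N → ℕ) b)).prod
      - (l.map (fun b => Z b ^ (β + Pi.single a 1 : Fin N → ℕ) b)).prod * X
      = ((ε * (β a + 1) : ℤ) : A) * (l.map (fun b => Z b ^ β b)).prod := by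
  induction l with
  | nil => simp at ha
  | cons b l ih =>
    rw [List.nodup_cons] at hl
    simp only [List.map_cons, List.prod_cons]
    by_cases hb : b = a
    · subst hb
      have h0 := comm_prod0 h l (β + Pi.single b 1 : Fin N → ℕ) (Or.inl hl.1)
      have hm : l.map (fun c => Z c ^ (β + Pi.single b 1 : Fin N → ℕ) c) = l.map (fun c => Z c ^ β c) := by
        apply List.map_congr_left
        intro c hc
        have : c ≠ b := fun h => hl.1 (h ▸ hc)
        simp [this]
      rw [hm] at h0 ⊢
      have h1 := comm_pow (by simpa using h b) (β b)
      have hbb : (β + Pi.single b 1 : Fin N → ℕ) b = β b + 1 := by simp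
      rw [hbb, ← mul_assoc (Int.cast _), ← h1, sub_mul]
      rw [sub_eq_zero] at h0
      simp only [mul_assoc, h0]
    · have ih := ih hl.2 (by simpa [Ne.symm hb] using ha)
      have hbb : (β + Pi.single a 1 : Fin N → ℕ) b = β b := by simp [hb]
      have h1 : X * Z b ^ β b - Z b ^ β b * X = 0 := by
        apply comm_pow0; rw [h, if_neg hb]
      rw [hbb, ← mul_assoc (Int.cast _), Int.cast_comm, mul_assoc (Z b ^ β b) (Int.cast _), ← ih, mul_sub]
      rw [sub_eq_zero] at h1
      simp only [← mul_assoc, h1]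

def degF (N i : ℕ) : Finset (Fin N → ℕ) := (finite_deg N i).toFinset
lemma mem_degF {N i : ℕ} {α : Fin N → ℕ} : α ∈ degF N i ↔ ∑ a, α a ≤ i := by simp [degF]

lemma card_degF (N i : ℕ) : (degF N i).card = (i + N).choose N := by
  rw [← HF_empty, HF, degF, ← Set.ncard_eq_toFinset_card _ (finite_deg N i)]
  simp

def WeylRel (Z : Fin N → A) : Prop :=
  ∀ a, ∃ a', ∃ ε : ℤ, ε ≠ 0 ∧ ∀ b, Z a' * Z b - Z b * Z a' = if b = a then (ε : A) else 0

lemma bern_vanish {L : Type*} [Field L] [CharZero L] [Module L V] [SMulCommClass A L V]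
    (hW : WeylRel Z) (v0 : V) (hv0 : v0 ≠ 0) (i : ℕ) (c : (Fin N → ℕ) → L)
    (hc : ∀ w : List (Fin N), w.length ≤ i →
      ∑ α ∈ degF N i, c α • (mn Z α • (opw Z w • v0)) = 0) :
    ∀ α ∈ degF N i, c α = 0 := by
  classical
  -- the constant coefficient
  have fin0 : ∀ i (c : (Fin N → ℕ) → L), (∑ α ∈ degF N i, c α • (mn Z α • (opw Z [] • v0)) = 0) →
      (∀ α ∈ degF N i, α ≠ 0 → c α = 0) → ∀ α ∈ degF N i, c α = 0 := by
    intro i c h h0 α hα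
    by_cases hα0 : α = 0
    · subst hα0
      rw [Finset.sum_eq_single_of_mem 0 hα (by intro b hb hb0; rw [h0 b hb hb0, zero_smul])] at h
      have : mn Z (0 : Fin N → ℕ) = 1 := by
        have : wd (0 : Fin N → ℕ) = [] := by
          rw [← List.length_eq_zero_iff, length_wd]; simp
        rw [mn, this, opw_nil]
      rw [this, opw_nil, one_smul, one_smul] at h
      exact (smul_eq_zero.1 h).resolve_right hv0
    · exact h0 α hα hα0
  induction i generalizing c with
  | zero =>
    apply fin0 0 c (hc [] (by simp))
    intro α hα hα0
    rw [mem_degF] at hα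
    exfalso; apply hα0
    funext a
    have : ∑ a, α a = 0 := by omega
    rw [Finset.sum_eq_zero_iff] at this
    exact this a (Finset.mem_univ a)
  | succ i ih =>
    apply fin0 (i + 1) c (hc [] (by simp))
    intro α hα hα0
    have : ∃ a, α a ≠ 0 := by
      by_contra hcon; push Not at hcon; exact hα0 (funext hcon)
    obtain ⟨a, ha⟩ := this
    obtain ⟨a', ε, hε, hcomm⟩ := hW a
    have key : ∀ β ∈ degF N i, c (β + Pi.single a 1) * ((ε * (β a + 1) : ℤ) : L) = 0 := by
      apply ih (fun β => c (β + Pi.single a 1) * ((ε * (β a + 1) : ℤ) : L))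
      intro w hw
      have e1 := hc w (by omega)
      have e2 := hc (a' :: w) (by simp; omega)
      have e3 : ∑ α ∈ degF N (i + 1), c α • ((Z a' * mn Z α - mn Z α * Z a') • (opw Z w • v0)) = 0 := by
        have : Z a' • ∑ α ∈ degF N (i + 1), c α • (mn Z α • (opw Z w • v0)) = 0 := by
          rw [e1, smul_zero]
        rw [Finset.smul_sum] at this
        rw [← sub_zero (0:V)]
        nth_rw 1 [← this]
        rw [← e2, ← Finset.sum_sub_distrib]
        apply Finset.sum_congr rfl
        intro α _
        rw [opw_cons, smul_comm (Z a') (c α), ← smul_sub, sub_smul, mul_smul, mul_smul, mul_smul]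
      let emb : (Fin N → ℕ) ↪ (Fin N → ℕ) := ⟨fun β => β + Pi.single a 1, add_left_injective _⟩
      have hsub : (degF N i).map emb ⊆ degF N (i + 1) := by
        intro β hβ
        rw [Finset.mem_map] at hβ
        obtain ⟨γ, hγ, rfl⟩ := hβ
        rw [mem_degF] at *
        change ∑ b, (γ + Pi.single a 1 : Fin N → ℕ) b ≤ _
        rw [sum_single]; omega
      have e4 := Finset.sum_subset (f := fun α => c α • ((Z a' * mn Z α - mn Z α * Z a') • (opw Z w • v0))) hsub (by
        intro β hβ hβ'
        have : β a = 0 := by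
          by_contra hb
          apply hβ'
          rw [Finset.mem_map]
          have e : β - Pi.single a 1 + Pi.single a 1 = β := by
            funext b
            by_cases hb' : b = a
            · subst hb'; simp; omega
            · simp [hb']
          refine ⟨β - Pi.single a 1, ?_, e⟩
          rw [mem_degF] at *
          have := sum_single (β - Pi.single a 1) a
          rw [e] at this; omega
        have h0 := comm_prod0 hcomm (List.finRange N) β (Or.inr this)
        rw [← opw_flatMap] at h0
        change c β • ((Z a' * mn Z β - mn Z β * Z a') • (opw Z w • v0)) = 0
        unfold mn wd
        rw [h0]; simp)
      rw [e3, Finset.sum_map] at e4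
      rw [← e4]
      apply Finset.sum_congr rfl
      intro β _
      have h1 := comm_prod1 hcomm (List.finRange N) (List.nodup_finRange N) (List.mem_finRange a) β
      rw [← opw_flatMap, ← opw_flatMap] at h1
      change _ = c (β + Pi.single a 1) • ((Z a' * mn Z (β + Pi.single a 1) - mn Z (β + Pi.single a 1) * Z a') • (opw Z w • v0))
      unfold mn wd
      rw [h1, mul_smul, mul_smul, Int.cast_smul_eq_zsmul, Int.cast_smul_eq_zsmul]
    have e : α - Pi.single a 1 + Pi.single a 1 = α := by
      funext b
      by_cases hb' : b = a
      · subst hb'; simp; omega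
      · simp [hb']
    have h1 := key (α - Pi.single a 1) (by
      rw [mem_degF] at *
      have := sum_single (α - Pi.single a 1) a
      rw [e] at this; omega)
    rw [e] at h1
    apply (mul_eq_zero.1 h1).resolve_right
    rw [← ne_eq, Int.cast_ne_zero]
    apply mul_ne_zero hε
    positivity

lemma mn_indep {L : Type*} [Field L] [CharZero L] [Algebra L A] (hW : WeylRel Z) [Nontrivial A] :
    LinearIndependent L (mn Z) := by
  rw [linearIndependent_iff']
  intro s c hs
  classical
  have : ∃ i, s ⊆ degF N i := ⟨∑ β ∈ s, ∑ a, β a, fun α hα => by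
    rw [mem_degF]; exact Finset.single_le_sum (f := fun β : Fin N → ℕ => ∑ a, β a) (fun _ _ => Nat.zero_le _) hα⟩
  obtain ⟨i, hi⟩ := this
  have h := bern_vanish (V := A) (L := L) hW 1 one_ne_zero i (fun α => if α ∈ s then c α else 0) (by
    intro w _
    have : ∑ α ∈ degF N i, (if α ∈ s then c α else 0) • (mn Z α • (opw Z w • (1:A)))
      = (∑ α ∈ s, c α • mn Z α) * (opw Z w • (1:A)) := by
      rw [Finset.sum_mul, ← Finset.sum_subset hi]
      · apply Finset.sum_congr rfl
        intro α hα; simp [hα]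
      · intro α _ hα; simp [hα]
    rw [this, hs, zero_mul])
  intro α hα
  have := h α (hi hα)
  simpa [hα] using this

lemma Mf_mul_mem {k : Type*} [Field k] [Module k V] [SMulCommClass A k V] {r : ℕ} (v : Fin r → V)
    (u : List (Fin N)) {i j : ℕ} (hu : u.length ≤ j) {x : V} (hx : x ∈ Mf Z k v i) :
    opw Z u • x ∈ Mf Z k v (i + j) := by
  have : Mf Z k v i ≤ (Mf Z k v (i + j)).comap (DistribSMul.toLinearMap k V (opw Z u)) := by
    unfold Mf
    rw [Submodule.span_le]
    rintro _ ⟨w, hw, l, rfl⟩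
    refine Submodule.subset_span ⟨u ++ w, by simp; omega, l, ?_⟩
    rw [opw_append, mul_smul]; rfl
  exact this hx

lemma bern_ineq {L : Type*} [Field L] [CharZero L] [Module L V] [SMulCommClass A L V]
    (hW : WeylRel Z) {r : ℕ} (v : Fin r → V) (j0 : Fin r) (hv0 : v j0 ≠ 0) (i : ℕ) :
    ((i + N).choose N : ℤ) ≤ hf Z L v i * hf Z L v (2 * i) := by
  classical
  let T : (degF N i → L) →ₗ[L] (Mf Z L v i →ₗ[L] Mf Z L v (2 * i)) :=
    Fintype.linearCombination L (fun α : degF N i =>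
      (DistribSMul.toLinearMap L V (mn Z α.1)).restrict (p := Mf Z L v i) (q := Mf Z L v (2 * i))
      (by
        intro x hx
        have := Mf_mul_mem v (wd α.1) (j := i) (by rw [length_wd]; exact mem_degF.1 α.2) hx
        rw [← two_mul] at this
        exact this))
  have hT : Function.Injective T := by
    rw [← LinearMap.ker_eq_bot, LinearMap.ker_eq_bot']
    intro c hc
    have := bern_vanish (L := L) hW (v j0) hv0 i (fun α => if h : α ∈ degF N i then c ⟨α, h⟩ else 0) (by
      intro w hw
      have hx : opw Z w • v j0 ∈ Mf Z L v i := Submodule.subset_span ⟨w, hw, j0, rfl⟩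
      have h2 := congrArg Subtype.val (LinearMap.congr_fun hc ⟨_, hx⟩)
      simp only [T, Fintype.linearCombination_apply] at h2
      rw [LinearMap.sum_apply] at h2
      simp only [Submodule.coe_sum, LinearMap.smul_apply, Submodule.coe_smul, LinearMap.zero_apply, Submodule.coe_zero] at h2
      rw [← Finset.sum_coe_sort]
      simp only [Finset.coe_mem, dite_true]
      exact h2)
    funext α
    have := this α.1 α.2
    simpa using this
  have h := LinearMap.finrank_le_finrank_of_injective hT
  rw [Module.finrank_linearMap, Module.finrank_fintype_fun_eq_card, Fintype.card_coe, card_degF] at h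
  unfold hf
  exact_mod_cast h

lemma bern_not_van {L : Type*} [Field L] [CharZero L] [Module L V] [SMulCommClass A L V]
    (hW : WeylRel Z) {r : ℕ} (v : Fin r → V) (j0 : Fin r) (hv0 : v j0 ≠ 0) {n : ℕ} (hn : 0 < n)
    (hN : N = 2 * n) : ¬ VanAt n (hf Z L v) := by
  intro h
  obtain ⟨d, rfl⟩ : ∃ d, n = d + 1 := ⟨n - 1, by omega⟩
  obtain ⟨C, hC⟩ := van_bound h
  have key : ∀ i : ℕ, ((i + N).choose N : ℤ) ≤ C ^ 2 * 2 ^ d * ((i : ℤ) + 1) ^ (2 * d) := by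
    intro i
    have h1 := bern_ineq (L := L) hW v j0 hv0 i
    have h2 := hC i
    have h3 := hC (2 * i)
    have p : ∀ i, 0 ≤ hf Z L v i := fun i => by unfold hf; positivity
    rw [abs_of_nonneg (p _)] at h2 h3
    calc _ ≤ _ := h1
      _ ≤ (C * ((i : ℤ) + 1) ^ d) * (C * (((2 * i : ℕ) : ℤ) + 1) ^ d) := by
        apply mul_le_mul h2 h3 (p _); positivity
      _ ≤ (C * ((i : ℤ) + 1) ^ d) * (C * (2 * ((i : ℤ) + 1)) ^ d) := by
        gcongr; push_cast; linarith
      _ = _ := by rw [mul_pow, pow_mul']; ring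
  have low : ∀ i : ℕ, ((i : ℤ) + 1) ^ N ≤ (N.factorial : ℤ) * ((i + N).choose N : ℤ) := by
    intro i
    have := Nat.pow_succ_le_ascFactorial (i + 1) N
    rw [Nat.ascFactorial_eq_factorial_mul_choose] at this
    exact_mod_cast this
  set D : ℤ := (N.factorial : ℤ) * (C ^ 2 * 2 ^ d) with hD
  have hD0 : 0 ≤ D := by positivity
  have h1 := low D.toNat
  have h2 := key D.toNat
  rw [Int.toNat_of_nonneg hD0] at h1 h2
  have h3 : (D + 1) ^ N ≤ D * (D + 1) ^ (2 * d) := by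
    refine h1.trans ?_
    rw [hD, mul_assoc (N.factorial : ℤ)]
    rw [← hD]
    gcongr
  have e : (D + 1) ^ N = (D + 1) ^ (2 * d) * (D + 1) ^ 2 := by
    rw [← pow_add, hN]; ring_nf
  rw [e, mul_comm] at h3
  have p : 0 < (D + 1) ^ (2 * d) := by positivity
  have := le_of_mul_le_mul_right h3 p
  nlinarith
end bern
end

section

section drop
lemma dim_drop {k k' V : Type*} [Field k] [Field k'] [Algebra k k'] [AddCommGroup V] [Module k V]
    [Module k' V] [IsScalarTower k k' V] (U' U : Submodule k V) (hU : U' ≤ U)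
    [FiniteDimensional k U] (x : k') (hx : Transcendental k x)
    (hxU : ∀ u ∈ U', x • u ∈ U) :
    Module.finrank k' (Submodule.span k' (U : Set V)) + Module.finrank k U' ≤ Module.finrank k U := by
  classical
  have fdU' : FiniteDimensional k U' := Submodule.finiteDimensional_of_le hU
  obtain ⟨W, hW⟩ := exists_isCompl U'
  set C := W ⊓ U with hC
  have fdC : FiniteDimensional k C := Submodule.finiteDimensional_of_le (inf_le_right : C ≤ U)
  have hsup : U' ⊔ C = U := by
    rw [hC, ← sup_inf_assoc_of_le W hU, hW.sup_eq_top, top_inf_eq]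
  have hinf : U' ⊓ C = ⊥ := by
    rw [hC, ← inf_assoc, hW.inf_eq_bot, bot_inf_eq]
  have hdim := Submodule.finrank_sup_add_finrank_inf_eq U' C
  rw [hsup, hinf, finrank_bot] at hdim
  set S := Submodule.span k' (C : Set V) with hS
  have hU'S : ∀ u ∈ U', u ∈ S := by
    intro u hu
    by_contra hne
    have hy : S.mkQ u ≠ 0 := by
      rw [ne_eq, Submodule.mkQ_apply, Submodule.Quotient.mk_eq_zero]; exact hne
    let q : V →ₗ[k] (V ⧸ S) := (S.mkQ).restrictScalars k
    have hpow : ∀ i : ℕ, x ^ i • S.mkQ u ∈ U'.map q := by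
      intro i
      induction i with
      | zero => exact ⟨u, hu, by simp [q]⟩
      | succ i ih =>
        obtain ⟨u1, hu1, h1⟩ := ih
        have h2 := hxU u1 hu1
        rw [← hsup, Submodule.mem_sup] at h2
        obtain ⟨a, ha, c, hc, hac⟩ := h2
        refine ⟨a, ha, ?_⟩
        rw [pow_succ', mul_smul, ← h1]
        change S.mkQ a = x • S.mkQ u1
        rw [← map_smul, ← hac, map_add]
        have : S.mkQ c = 0 := by
          rw [Submodule.mkQ_apply, Submodule.Quotient.mk_eq_zero]
          exact Submodule.subset_span hc
        rw [this, add_zero]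
    have hli : LinearIndependent k (fun i : ℕ => x ^ i • S.mkQ u) := by
      have h1 : LinearIndependent k (fun i : ℕ => x ^ i) := by
        rw [transcendental_iff_injective] at hx
        have := (Polynomial.basisMonomials k).linearIndependent.map'
          (Polynomial.aeval x).toLinearMap (LinearMap.ker_eq_bot.2 hx)
        have e : (fun i : ℕ => x ^ i) =
            (Polynomial.aeval x).toLinearMap ∘ (Polynomial.basisMonomials k) := by
          funext i
          simp [Polynomial.coe_basisMonomials]
        rw [e]; exact this
      exact h1.map' (LinearMap.toSpanSingleton k' (V ⧸ S) (S.mkQ u) |>.restrictScalars k) (by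
        rw [LinearMap.ker_eq_bot]
        intro a b hab
        simp only [LinearMap.coe_restrictScalars, LinearMap.toSpanSingleton_apply] at hab
        exact smul_left_injective k' hy hab)
    let f : ℕ → U'.map q := fun i => ⟨x ^ i • S.mkQ u, hpow i⟩
    have hf : LinearIndependent k f := by
      apply LinearIndependent.of_comp (U'.map q).subtype
      exact hli
    have := hf.finite
    exact not_finite ℕ
  have hSU : Submodule.span k' (U : Set V) ≤ S := by
    rw [Submodule.span_le]
    intro u hu
    rw [← hsup] at hu
    obtain ⟨a, ha, c, hc, rfl⟩ := Submodule.mem_sup.1 hu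
    exact S.add_mem (hU'S a ha) (Submodule.subset_span hc)
  have hSdim : S = Submodule.span k' (Set.range (fun i => ((Module.finBasis k C) i : V))) := by
    apply le_antisymm
    · rw [hS, Submodule.span_le]
      intro c hc
      have h1 : (⟨c, hc⟩ : C) ∈ Submodule.span k (Set.range (Module.finBasis k C)) := by
        rw [(Module.finBasis k C).span_eq]; trivial
      have h2 : C.subtype ⟨c, hc⟩ ∈ (Submodule.span k (Set.range (Module.finBasis k C))).map C.subtype :=
        ⟨_, h1, rfl⟩
      rw [Submodule.map_span, ← Set.range_comp] at h2
      exact Submodule.span_le_restrictScalars k k' _ h2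
    · rw [Submodule.span_le]
      rintro _ ⟨i, rfl⟩
      exact Submodule.subset_span (Module.finBasis k C i).2
  have hr : Module.finrank k' S ≤ Module.finrank k C := by
    rw [hSdim]
    have := finrank_range_le_card (R := k') (fun i => ((Module.finBasis k C) i : V))
    rw [Fintype.card_fin] at this
    exact this
  have fdS : FiniteDimensional k' S := by
    rw [hSdim]; exact FiniteDimensional.span_of_finite _ (Set.finite_range _)
  have := Submodule.finrank_mono hSU
  omega
end drop

section step
variable {K A V : Type*} [Field K] [Ring A] [Algebra K A] [AddCommGroup V] [Module A V]
  [Module K V] [IsScalarTower K A V] {N : ℕ} {Z : Fin N → A}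

/-- every element of `A` has bounded degree -/
lemma exists_deg (hgen : Algebra.adjoin K (Set.range Z) = ⊤) (a : A) :
    ∃ c, a ∈ Submodule.span K {x | ∃ w : List (Fin N), w.length ≤ c ∧ x = opw Z w} := by
  have h : a ∈ Algebra.adjoin K (Set.range Z) := by rw [hgen]; trivial
  induction h using Algebra.adjoin_induction with
  | mem x hx =>
    obtain ⟨b, rfl⟩ := hx
    exact ⟨1, Submodule.subset_span ⟨[b], by simp, by simp [opw]⟩⟩
  | algebraMap r =>
    refine ⟨0, ?_⟩
    rw [Algebra.algebraMap_eq_smul_one]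
    exact Submodule.smul_mem _ _ (Submodule.subset_span ⟨[], by simp, rfl⟩)
  | add x y _ _ hx hy =>
    obtain ⟨c, hc⟩ := hx
    obtain ⟨d, hd⟩ := hy
    refine ⟨c + d, Submodule.add_mem _ (Submodule.span_mono ?_ hc) (Submodule.span_mono ?_ hd)⟩
    · rintro _ ⟨w, hw, rfl⟩; exact ⟨w, by omega, rfl⟩
    · rintro _ ⟨w, hw, rfl⟩; exact ⟨w, by omega, rfl⟩
  | mul x y _ _ hx hy =>
    obtain ⟨c, hc⟩ := hx
    obtain ⟨d, hd⟩ := hy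
    refine ⟨c + d, ?_⟩
    have := Submodule.mul_mem_mul hc hd
    rw [Submodule.span_mul_span] at this
    refine Submodule.span_mono ?_ this
    rintro _ ⟨_, ⟨w, hw, rfl⟩, _, ⟨w', hw', rfl⟩, rfl⟩
    exact ⟨w ++ w', by simp; omega, (opw_append Z w w').symm⟩

lemma Mf_mono {k : Type*} [Field k] [Module k V] {r : ℕ} (v : Fin r → V) {i j : ℕ} (h : i ≤ j) :
    Mf Z k v i ≤ Mf Z k v j := by
  apply Submodule.span_mono
  rintro _ ⟨w, hw, l, rfl⟩; exact ⟨w, by omega, l, rfl⟩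

lemma deg_smul {k : Type*} [Field k] [Algebra K k] [Module k V] [IsScalarTower K k V]
    [SMulCommClass A k V] {r : ℕ} (v : Fin r → V)
    {a : A} {c : ℕ} (ha : a ∈ Submodule.span K {x | ∃ w : List (Fin N), w.length ≤ c ∧ x = opw Z w})
    {i : ℕ} {x : V} (hx : x ∈ Mf Z k v i) : a • x ∈ Mf Z k v (i + c) := by
  induction ha using Submodule.span_induction with
  | mem a h => obtain ⟨w, hw, rfl⟩ := h; exact Mf_mul_mem v w hw hx
  | zero => simp
  | add a b _ _ h1 h2 => rw [add_smul]; exact Submodule.add_mem _ h1 h2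
  | smul t a _ h =>
    rw [smul_assoc, ← algebraMap_smul k t (a • x)]
    exact Submodule.smul_mem _ _ h

lemma exists_deg_fin (hgen : Algebra.adjoin K (Set.range Z) = ⊤) {ι : Type*} [Finite ι] (a : ι → A) :
    ∃ c, ∀ j, a j ∈ Submodule.span K {x | ∃ w : List (Fin N), w.length ≤ c ∧ x = opw Z w} := by
  classical
  have := Fintype.ofFinite ι
  choose c hc using fun j => exists_deg hgen (a j)
  refine ⟨∑ j, c j, fun j => Submodule.span_mono ?_ (hc j)⟩
  rintro _ ⟨w, hw, rfl⟩
  exact ⟨w, hw.trans (Finset.single_le_sum (f := c) (fun _ _ => Nat.zero_le _) (Finset.mem_univ j)), rfl⟩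

/-- the key inequality -/
lemma key_ineq (hgen : Algebra.adjoin K (Set.range Z) = ⊤) [NoZeroDivisors A]
    {k k' : Type*} [Field k] [Field k'] [Algebra K k] [Algebra k k']
    [Module k V] [Module k' V] [IsScalarTower K k V] [IsScalarTower k k' V] [SMulCommClass A k V]
    [SMulCommClass A k' V] (x : k') (hx : Transcendental k x) {ρ : ℕ}
    (hρ : ∀ v : Fin (ρ + 1) → V, ¬ LinearIndependent A v) (v : Fin ρ → V)
    (hv : LinearIndependent A v) :
    ∃ (u : Fin ρ → V) (c : ℕ), LinearIndependent A u ∧ (∀ i, hf Z k u i ≤ hf Z k v (i + c)) ∧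
      ∀ i, hf Z k' v (i + c) + hf Z k u i ≤ hf Z k v (i + c) := by
  have h1 : ∀ j, ∃ s : A, s ≠ 0 ∧ ∃ b : Fin ρ → A, s • (x • v j) = ∑ l, b l • v l := by
    intro j
    have := mt (LinearIndependent.finCons' (x • v j) v hv) (hρ _)
    push Not at this
    obtain ⟨c, y, hy, h, hc⟩ := this
    refine ⟨c, hc, ?_⟩
    rw [Submodule.mem_span_range_iff_exists_fun] at hy
    obtain ⟨b, hb⟩ := hy
    refine ⟨fun l => - b l, ?_⟩
    simp only [neg_smul, Finset.sum_neg_distrib, hb]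
    exact eq_neg_of_add_eq_zero_left h
  choose s hs b hb using h1
  obtain ⟨c1, hc1⟩ := exists_deg_fin hgen s
  obtain ⟨c2, hc2⟩ := exists_deg_fin hgen (fun p : Fin ρ × Fin ρ => b p.1 p.2)
  have base : ∀ l, v l ∈ Mf Z k v 0 := fun l => Submodule.subset_span ⟨[], by simp, l, by simp [opw]⟩
  have hle : ∀ i, Mf Z k (fun j => s j • v j) i ≤ Mf Z k v (i + (c1 + c2)) := by
    intro i
    refine Submodule.span_le.2 ?_
    rintro _ ⟨w, hw, l, rfl⟩
    have := Mf_mul_mem v w hw (deg_smul (k := k) v (hc1 l) (base l))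
    exact Mf_mono v (by omega) this
  refine ⟨fun j => s j • v j, c1 + c2, ?_, ?_, ?_⟩
  · rw [Fintype.linearIndependent_iff] at hv ⊢
    intro g hg j
    have := hv (fun j => g j * s j) (by simpa only [mul_smul] using hg) j
    exact (mul_eq_zero.1 this).resolve_right (hs j)
  · intro i
    unfold hf
    exact_mod_cast Submodule.finrank_mono (hle i)
  · intro i
    have := dim_drop (Mf Z k (fun j => s j • v j) i) (Mf Z k v (i + (c1 + c2))) (hle i) x hx (by
      intro u hu
      unfold Mf at hu
      induction hu using Submodule.span_induction with
      | mem u h =>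
        obtain ⟨w, hw, l, rfl⟩ := h
        rw [← smul_comm (opw Z w) x, ← smul_comm (s l) x, hb]
        have : ∑ l', b l l' • v l' ∈ Mf Z k v (0 + c2) :=
          Submodule.sum_mem _ (fun l' _ => deg_smul (k := k) v (hc2 (l, l')) (base l'))
        exact Mf_mono v (by omega) (Mf_mul_mem v w hw this)
      | zero => simp
      | add a b _ _ h1 h2 => rw [smul_add]; exact Submodule.add_mem _ h1 h2
      | smul t a _ h =>
        have : x • t • a = t • x • a := by
          rw [← algebraMap_smul k' t a, ← algebraMap_smul k' t (x • a), ← mul_smul, mul_comm, mul_smul]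
        rw [this]
        exact Submodule.smul_mem _ _ h)
    have e : Submodule.span k' (Mf Z k v (i + (c1 + c2)) : Set V) = Mf Z k' v (i + (c1 + c2)) :=
      Submodule.span_span_of_tower k k' _
    rw [e] at this
    unfold hf
    exact_mod_cast this

lemma hf_nonneg {k : Type*} [Field k] [Module k V] {r : ℕ} (v : Fin r → V) (i : ℕ) :
    0 ≤ hf Z k v i := by unfold hf; positivity

lemma core_step (hgen : Algebra.adjoin K (Set.range Z) = ⊤) [NoZeroDivisors A]
    (hZ : ∀ a b, ∃ c : ℤ, Z a * Z b - Z b * Z a = c)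
    {k k' : Type*} [Field k] [Field k'] [Algebra K k] [Algebra k k']
    [Module k V] [Module k' V] [IsScalarTower K k V] [IsScalarTower k k' V] [SMulCommClass A k V]
    [SMulCommClass A k' V] (x : k') (hx : Transcendental k x) {ρ : ℕ} (hρ0 : ρ ≠ 0) [Nontrivial A]
    (hρ : ∀ v : Fin (ρ + 1) → V, ¬ LinearIndependent A v) (D : ℕ)
    (hD : ∃ v : Fin ρ → V, LinearIndependent A v ∧ VanAt (D + 1) (hf Z k v)) :
    ∃ v : Fin ρ → V, LinearIndependent A v ∧ VanAt D (hf Z k' v) := by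
  classical
  have hex : ∃ d, ∃ v : Fin ρ → V, LinearIndependent A v ∧ VanAt d (hf Z k v) := ⟨_, hD⟩
  have hmin := Nat.find_min' hex hD
  have hsp := Nat.find_spec hex
  have hmin2 : ∀ d, (∃ v : Fin ρ → V, LinearIndependent A v ∧ VanAt d (hf Z k v)) → Nat.find hex ≤ d :=
    fun d hd => Nat.find_min' hex hd
  generalize Nat.find hex = d0 at *
  rcases d0 with _ | d
  · exfalso
    obtain ⟨v, hv, hvan⟩ := hsp
    obtain ⟨i, hi⟩ := Filter.Eventually.exists hvan
    have hi' : hf Z k v i = 0 := hi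
    have hne := hv.ne_zero (⟨0, Nat.pos_of_ne_zero hρ0⟩ : Fin ρ)
    unfold hf at hi'
    have h0 : Module.finrank k (Mf Z k v i) = 0 := by exact_mod_cast hi'
    rw [Submodule.finrank_eq_zero] at h0
    have : v ⟨0, Nat.pos_of_ne_zero hρ0⟩ ∈ Mf Z k v i :=
      Submodule.subset_span ⟨[], by simp, ⟨0, Nat.pos_of_ne_zero hρ0⟩, by simp [opw]⟩
    rw [h0] at this
    exact hne (by simpa using this)
  · have hex2 : ∃ e : ℕ, ∃ v : Fin ρ → V, LinearIndependent A v ∧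
        ∀ᶠ i in atTop, dl^[d] (hf Z k v) i = e := by
      obtain ⟨v, hv, hvan⟩ := hsp
      obtain ⟨e, he⟩ := van_const hvan
      have : 0 ≤ e := by
        by_contra hneg
        apply van_pos d (hf Z k v) (Filter.Eventually.of_forall (hf_nonneg v))
        filter_upwards [he] with i hi
        omega
      exact ⟨e.toNat, v, hv, by rwa [Int.toNat_of_nonneg this]⟩
    have hm2 : ∀ e : ℕ, (∃ v : Fin ρ → V, LinearIndependent A v ∧
        ∀ᶠ i in atTop, dl^[d] (hf Z k v) i = e) → Nat.find hex2 ≤ e := fun e he => Nat.find_min' hex2 he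
    obtain ⟨v, hv, he⟩ := Nat.find_spec hex2
    generalize Nat.find hex2 = e at *
    obtain ⟨u, c, hu, h1, h2⟩ := key_ineq (k := k) (k' := k') hgen x hx hρ v hv
    refine ⟨v, hv, ?_⟩
    have hvan : VanAt (d + 1) (hf Z k v) := by
      unfold VanAt
      rw [Function.iterate_succ']
      obtain ⟨n0, hn0⟩ := Filter.eventually_atTop.1 he
      refine Filter.eventually_atTop.2 ⟨n0, fun i hi => ?_⟩
      simp only [Function.comp, dl]
      rw [hn0 i hi, hn0 (i + 1) (by omega), sub_self]
    have hvu : VanAt (d + 1) (hf Z k u) := by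
      obtain ⟨d', hd'⟩ := hf_van Z u hZ (k := k)
      exact van_cmp (Filter.Eventually.of_forall (hf_nonneg u)) (Filter.Eventually.of_forall h1) hd'
        (hvan.shift c)
    obtain ⟨e', he'⟩ := van_const hvu
    have he'0 : 0 ≤ e' := by
      by_contra hneg
      apply van_pos d (hf Z k u) (Filter.Eventually.of_forall (hf_nonneg u))
      filter_upwards [he'] with i hi
      omega
    have hee' : (e : ℤ) ≤ e' := by
      have := hm2 e'.toNat ⟨u, hu, by rwa [Int.toNat_of_nonneg he'0]⟩
      omega
    set q : ℕ → ℤ := (fun i => hf Z k v (i + c)) - hf Z k u with hq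
    have hq0 : ∀ i, 0 ≤ q i := fun i => by
      simp only [hq, Pi.sub_apply]; linarith [h1 i]
    have hqe : ∀ᶠ i in atTop, dl^[d] q i = e - e' := by
      rw [hq, dl_iter_sub]
      have hes : ∀ᶠ i in atTop, dl^[d] (hf Z k v) (i + c) = e :=
        (tendsto_add_atTop_nat c).eventually he
      filter_upwards [hes, he'] with i h1 h2
      rw [Pi.sub_apply, dl_iter_shift, h1, h2]
    have hqvan : VanAt d q := by
      have : (e : ℤ) - e' = 0 := by
        by_contra hne
        apply van_pos d q (Filter.Eventually.of_forall hq0)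
        filter_upwards [hqe] with i hi
        omega
      rw [this] at hqe; exact hqe
    have hfin : VanAt d (fun i => hf Z k' v (i + c)) := by
      obtain ⟨d', hd'⟩ := hf_van Z v hZ (k := k')
      refine van_cmp (Filter.Eventually.of_forall (fun i => hf_nonneg v _))
        (Filter.Eventually.of_forall (fun i => ?_)) (hd'.shift c) hqvan
      simp only [hq, Pi.sub_apply]; linarith [h2 i]
    exact (VanAt.unshift c hfin).mono (by omega)

open scoped IntermediateField.algebraAdjoinAdjoin in
lemma transc_adjoin {L : Type*} [Field L] [Algebra K L] {m : ℕ} (x : Fin m → L)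
    (hx : AlgebraicIndependent K x) (s : Set (Fin m)) (i : Fin m) (hi : i ∉ s) :
    Transcendental (IntermediateField.adjoin K (x '' s)) (x i) := by
  have := hx.transcendental_adjoin hi
  intro h
  apply this
  exact (IsFractionRing.isAlgebraic_iff (Algebra.adjoin K (x '' s)) (IntermediateField.adjoin K (x '' s)) L).2 h

theorem core (hgen : Algebra.adjoin K (Set.range Z) = ⊤) [NoZeroDivisors A] [Nontrivial A]
    [CharZero K] [Nontrivial V]
    (hZ : ∀ a b, ∃ c : ℤ, Z a * Z b - Z b * Z a = c) (hW : WeylRel Z)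
    (htf : ∀ (a : A) (v : V), a • v = 0 → a = 0 ∨ v = 0)
    (ρ0 : ℕ) (hρ0 : ∀ r (v : Fin r → V), LinearIndependent A v → r ≤ ρ0)
    {L : Type*} [Field L] [Algebra K L] [Module L V] [IsScalarTower K L V] [SMulCommClass A L V]
    {m n : ℕ} (hn : 0 < n) (hN : N = 2 * n) (x : Fin m → L) (hx : AlgebraicIndependent K x) :
    m ≤ n := by
  by_contra hmn
  have hmn : n < m := by omega
  have : CharZero L := charZero_of_injective_algebraMap (algebraMap K L).injective
  obtain ⟨ρ, hρ1, hρ2⟩ : ∃ ρ, (∃ v : Fin ρ → V, LinearIndependent A v) ∧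
      ∀ v : Fin (ρ + 1) → V, ¬ LinearIndependent A v := by
    by_contra hcon
    push Not at hcon
    have : ∀ ρ, ∃ v : Fin ρ → V, LinearIndependent A v := by
      intro ρ
      induction ρ with
      | zero => exact ⟨Fin.elim0, linearIndependent_empty_type⟩
      | succ ρ ih => exact hcon ρ ih
    obtain ⟨v, hv⟩ := this (ρ0 + 1)
    have := hρ0 _ v hv
    omega
  have hρne : ρ ≠ 0 := by
    rintro rfl
    obtain ⟨v0, hv0⟩ := exists_ne (0 : V)
    apply hρ2 (fun _ => v0)
    rw [Fintype.linearIndependent_iff]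
    intro g hg j
    rw [Fin.sum_univ_one] at hg
    have hj : j = 0 := by apply Fin.ext; have := j.2; omega
    rw [hj]
    exact (htf _ _ hg).resolve_right hv0
  have claim : ∀ j, j ≤ m → j ≤ 2 * n + 1 → ∃ v : Fin ρ → V, LinearIndependent A v ∧
      VanAt (2 * n + 1 - j) (hf Z (IntermediateField.adjoin K (x '' {l | l.1 < j})) v) := by
    intro j
    induction j with
    | zero =>
      intro _ _
      obtain ⟨v, hv⟩ := hρ1
      refine ⟨v, hv, ?_⟩
      rw [← hN]
      exact hf_van_N Z v hZ
    | succ j ih =>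
      intro hj hj2
      have ih := ih (by omega) (by omega)
      rw [show 2 * n + 1 - j = (2 * n + 1 - (j + 1)) + 1 by omega] at ih
      have hle : IntermediateField.adjoin K (x '' {l | l.1 < j}) ≤
          IntermediateField.adjoin K (x '' {l | l.1 < j + 1}) := by
        apply IntermediateField.adjoin.mono
        apply Set.image_mono
        intro l hl
        exact Nat.lt_succ_of_lt hl
      letI : Algebra (IntermediateField.adjoin K (x '' {l | l.1 < j}))
          (IntermediateField.adjoin K (x '' {l | l.1 < j + 1})) :=
        (IntermediateField.inclusion hle).toRingHom.toAlgebra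
      haveI : IsScalarTower (IntermediateField.adjoin K (x '' {l | l.1 < j}))
          (IntermediateField.adjoin K (x '' {l | l.1 < j + 1})) V := by
        refine ⟨fun a b v => ?_⟩
        change ((a : L) * (b : L)) • v = (a : L) • ((b : L) • v)
        rw [mul_smul]
      haveI : IsScalarTower K (IntermediateField.adjoin K (x '' {l | l.1 < j})) V := by
        refine ⟨fun a b v => ?_⟩
        change (((a • b : IntermediateField.adjoin K (x '' {l | l.1 < j})) : L)) • v = a • ((b : L) • v)
        rw [IntermediateField.coe_smul, smul_assoc]
      have hxm : x ⟨j, hj⟩ ∈ IntermediateField.adjoin K (x '' {l | l.1 < j + 1}) :=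
        IntermediateField.subset_adjoin _ _ ⟨⟨j, hj⟩, by simp, rfl⟩
      refine core_step hgen hZ (⟨x ⟨j, hj⟩, hxm⟩ : IntermediateField.adjoin K (x '' {l | l.1 < j + 1}))
        ?_ hρne hρ2 _ ih
      have ht := transc_adjoin x hx {l | l.1 < j} ⟨j, hj⟩ (by simp)
      haveI : IsScalarTower (IntermediateField.adjoin K (x '' {l | l.1 < j}))
          (IntermediateField.adjoin K (x '' {l | l.1 < j + 1})) L := by
        refine ⟨fun a b v => ?_⟩
        change ((a : L) * (b : L)) * v = (a : L) * ((b : L) * v)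
        rw [mul_assoc]
      intro hal
      exact ht (hal.algebraMap (A := L))
  obtain ⟨v, hv, hvan⟩ := claim (n + 1) (by omega) (by omega)
  rw [show 2 * n + 1 - (n + 1) = n by omega] at hvan
  exact bern_not_van hW v ⟨0, Nat.pos_of_ne_zero hρne⟩ (hv.ne_zero _) hn hN hvan
end step
end

section
section rank
variable {K A V : Type*} [Field K] [Ring A] [Algebra K A] [AddCommGroup V] [Module A V]
  [Module K V] [IsScalarTower K A V] {N : ℕ} {Z : Fin N → A}

lemma dl_choose (N : ℕ) (i : ℕ) : dl^[N] (fun i => ((i + N).choose N : ℤ)) i = 1 := by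
  induction N generalizing i with
  | zero => simp
  | succ N ih =>
    rw [Function.iterate_succ_apply]
    have : dl (fun i => ((i + (N + 1)).choose (N + 1) : ℤ))
        = fun i => (((i + 1) + N).choose N : ℤ) := by
      funext i
      simp only [dl]
      have : (i + 1 + (N + 1)).choose (N + 1) = (i + 1 + N).choose N + (i + (N + 1)).choose (N + 1) := by
        rw [show i + 1 + (N + 1) = (i + 1 + N) + 1 by ring, Nat.choose_succ_succ]
        congr 2; ring
      rw [this]; push_cast; ring
    rw [this, dl_iter_shift N 1 (fun i => ((i + N).choose N : ℤ))]
    exact ih _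

lemma dl_iter_smul (d : ℕ) (c : ℤ) (f : ℕ → ℤ) (i : ℕ) :
    dl^[d] (fun i => c * f i) i = c * dl^[d] f i := by
  induction d generalizing f i with
  | zero => rfl
  | succ d ih =>
    rw [Function.iterate_succ_apply, Function.iterate_succ_apply, ← ih]
    have : dl (fun i => c * f i) = fun i => c * dl f i := by
      funext i; simp [dl]; ring
    rw [this]

lemma mn_smul_indep [CharZero K] [Nontrivial A] (hW : WeylRel Z) {r : ℕ} (v : Fin r → V)
    (hv : LinearIndependent A v) :
    LinearIndependent K (fun p : (Fin N → ℕ) × Fin r => mn Z p.1 • v p.2) := by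
  classical
  rw [linearIndependent_iff']
  intro s c hs p hp
  have hm := mn_indep (L := K) hW
  rw [linearIndependent_iff'] at hm
  rw [Fintype.linearIndependent_iff] at hv
  have key := hv (fun j => ∑ α ∈ s.image Prod.fst, (if (α, j) ∈ s then c (α, j) else 0) • mn Z α) ?_ p.2
  · have := hm _ _ key p.1 (Finset.mem_image_of_mem _ hp)
    simpa [hp] using this
  · rw [← hs]
    simp_rw [Finset.sum_smul, smul_assoc]
    rw [Finset.sum_comm, ← Finset.sum_product']
    symm
    refine Finset.sum_subset_zero_on_sdiff ?_ ?_ ?_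
    · intro x hx
      exact Finset.mem_product.2 ⟨Finset.mem_image_of_mem _ hx, Finset.mem_univ _⟩
    · intro x hx
      rw [Finset.mem_sdiff] at hx
      simp [hx.2]
    · intro x hx
      simp [hx]

lemma hf_ge [CharZero K] [Nontrivial A] (hZ : ∀ a b, ∃ c : ℤ, Z a * Z b - Z b * Z a = c)
    (hW : WeylRel Z) {r : ℕ} (v : Fin r → V) (hv : LinearIndependent A v) (i : ℕ) :
    (r : ℤ) * ((i + N).choose N : ℤ) ≤ hf Z K v i := by
  classical
  haveI : SMulCommClass A K V := ⟨fun a k v => by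
    rw [← algebraMap_smul A k, ← algebraMap_smul A k, ← mul_smul, ← mul_smul, Algebra.commutes]⟩
  have h1 := (mn_smul_indep (K := K) hW v hv).comp
    (fun q : degF N i × Fin r => (q.1.1, q.2)) (by
      rintro ⟨⟨a, ha⟩, b⟩ ⟨⟨a', ha'⟩, b'⟩ h; simp only [Prod.mk.injEq] at h; simp [h.1, h.2])
  have h2 : ∀ q : degF N i × Fin r, (mn Z q.1.1 • v q.2) ∈ Mf Z K v i := by
    intro q
    rw [Mf_eq_mn Z v hZ]
    exact Submodule.subset_span ⟨(q.1.1, q.2), mem_degF.1 q.1.2, rfl⟩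
  have h3 : LinearIndependent K (fun q : degF N i × Fin r => (⟨_, h2 q⟩ : Mf Z K v i)) := by
    apply LinearIndependent.of_comp (Mf Z K v i).subtype
    exact h1
  have := h3.fintype_card_le_finrank
  rw [Fintype.card_prod, Fintype.card_coe, card_degF, Fintype.card_fin] at this
  unfold hf
  rw [mul_comm]
  exact_mod_cast this

lemma rank_gen [CharZero K] [Nontrivial A] (hgen : Algebra.adjoin K (Set.range Z) = ⊤)
    (hZ : ∀ a b, ∃ c : ℤ, Z a * Z b - Z b * Z a = c)
    (hW : WeylRel Z) {r t : ℕ} (b : Fin t → V) (v : Fin r → V) (hv : LinearIndependent A v)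
    (hb : ∀ j, v j ∈ Submodule.span A (Set.range b)) : r ≤ t := by
  classical
  haveI : SMulCommClass A K V := ⟨fun a k v => by
    rw [← algebraMap_smul A k, ← algebraMap_smul A k, ← mul_smul, ← mul_smul, Algebra.commutes]⟩
  simp_rw [Submodule.mem_span_range_iff_exists_fun] at hb
  choose a ha using hb
  obtain ⟨c, hc⟩ := exists_deg_fin hgen (fun p : Fin r × Fin t => a p.1 p.2)
  have hvm : ∀ j, v j ∈ Mf Z K b c := by
    intro j
    rw [← ha j]
    refine Submodule.sum_mem _ fun l _ => ?_
    have := deg_smul (K := K) (k := K) b (hc (j, l)) (i := 0) (x := b l)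
      (Submodule.subset_span ⟨[], by simp, l, by simp [opw]⟩)
    simpa using this
  have hle : ∀ i, Mf Z K v i ≤ Mf Z K b (i + c) := by
    intro i
    apply Submodule.span_le.2
    rintro _ ⟨w, hw, j, rfl⟩
    have := Mf_mul_mem b w hw (hvm j)
    rwa [add_comm] at this
  have h1 : ∀ i, (r : ℤ) * ((i + N).choose N : ℤ) ≤ t * ((i + c + N).choose N : ℤ) := by
    intro i
    refine (hf_ge (K := K) hZ hW v hv i).trans (le_trans ?_ (hf_le Z (k := K) b hZ (i + c)))
    unfold hf
    exact_mod_cast Submodule.finrank_mono (hle i)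
  by_contra hlt
  push Not at hlt
  refine van_pos N ((fun i => (t : ℤ) * ((i + c + N).choose N : ℤ)) -
    (fun i => (r : ℤ) * ((i + N).choose N : ℤ))) (Eventually.of_forall fun i => ?_) (Eventually.of_forall fun i => ?_)
  · simpa using h1 i
  · rw [dl_iter_sub, Pi.sub_apply, dl_iter_smul N (t : ℤ) (fun i => ((i + c + N).choose N : ℤ)),
      dl_iter_smul, dl_choose, dl_iter_shift N c (fun i => ((i + N).choose N : ℤ)), dl_choose]
    have : (t : ℤ) + 1 ≤ r := by exact_mod_cast hlt
    linarith

lemma ore_of [CharZero K] [Nontrivial A] [NoZeroDivisors A]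
    (hgen : Algebra.adjoin K (Set.range Z) = ⊤)
    (hZ : ∀ a b, ∃ c : ℤ, Z a * Z b - Z b * Z a = c)
    (hW : WeylRel Z) (a b : A) (hb : b ≠ 0) : ∃ s a' : A, s ≠ 0 ∧ s * a = a' * b := by
  have : ¬ LinearIndependent A ![a, b] := by
    intro h
    have := rank_gen (K := K) hgen hZ hW (fun _ : Fin 1 => (1 : A)) _ h (fun j => by
      rw [Submodule.mem_span_range_iff_exists_fun]
      exact ⟨fun _ => ![a, b] j, by simp⟩)
    omega
  rw [LinearIndependent.pair_iff] at this
  push Not at this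
  obtain ⟨x, y, h1, h2⟩ := this
  simp only [smul_eq_mul] at h1
  refine ⟨x, -y, ?_, ?_⟩
  · rintro rfl
    simp only [zero_mul, zero_add] at h1
    exact h2 rfl ((mul_eq_zero.1 h1).resolve_right hb)
  · rw [neg_mul]; exact eq_neg_of_add_eq_zero_left h1

/-- closure of a submodule -/
def clos [NoZeroDivisors A] [Nontrivial A] (ho : ∀ a b : A, b ≠ 0 → ∃ s a' : A, s ≠ 0 ∧ s * a = a' * b)
    (M : Submodule A V) : Submodule A V where
  carrier := {e | ∃ s : A, s ≠ 0 ∧ s • e ∈ M}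
  zero_mem' := ⟨1, one_ne_zero, by simp⟩
  add_mem' := by
    rintro x y ⟨s, hs, hx⟩ ⟨s', hs', hy⟩
    obtain ⟨p, q, hp, hpq⟩ := ho s s' hs'
    refine ⟨p * s, mul_ne_zero hp hs, ?_⟩
    rw [smul_add]
    refine M.add_mem ?_ ?_
    · rw [mul_smul]; exact M.smul_mem _ hx
    · rw [hpq, mul_smul]; exact M.smul_mem _ hy
  smul_mem' := by
    rintro a x ⟨s, hs, hx⟩
    obtain ⟨p, q, hp, hpq⟩ := ho a s hs
    refine ⟨p, hp, ?_⟩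
    rw [← mul_smul, hpq, mul_smul]; exact M.smul_mem _ hx

lemma mem_clos [NoZeroDivisors A] [Nontrivial A] (ho : ∀ a b : A, b ≠ 0 → ∃ s a' : A, s ≠ 0 ∧ s * a = a' * b)
    (M : Submodule A V) (e : V) : e ∈ clos ho M ↔ ∃ s : A, s ≠ 0 ∧ s • e ∈ M := Iff.rfl

lemma clos_clos [NoZeroDivisors A] [Nontrivial A] (ho : ∀ a b : A, b ≠ 0 → ∃ s a' : A, s ≠ 0 ∧ s * a = a' * b)
    (M : Submodule A V) (e : V) (s : A) (hs : s ≠ 0) (h : s • e ∈ clos ho M) : e ∈ clos ho M := by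
  obtain ⟨p, hp, h⟩ := h
  exact ⟨p * s, mul_ne_zero hp hs, by rwa [mul_smul]⟩

lemma rank_clos [CharZero K] [Nontrivial A] [NoZeroDivisors A]
    (hgen : Algebra.adjoin K (Set.range Z) = ⊤)
    (hZ : ∀ a b, ∃ c : ℤ, Z a * Z b - Z b * Z a = c)
    (hW : WeylRel Z) {r t : ℕ} (b : Fin t → V) (v : Fin r → V) (hv : LinearIndependent A v)
    (ho : ∀ a b : A, b ≠ 0 → ∃ s a' : A, s ≠ 0 ∧ s * a = a' * b)
    (hb : ∀ j, v j ∈ clos ho (Submodule.span A (Set.range b))) : r ≤ t := by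
  choose s hs hm using hb
  refine rank_gen (K := K) hgen hZ hW b (fun j => s j • v j) ?_ hm
  rw [Fintype.linearIndependent_iff] at hv ⊢
  intro c hc j
  have := hv (fun j => c j * s j) (by simpa [mul_smul] using hc) j
  exact (mul_eq_zero.1 this).resolve_right (hs j)
end rank
end

section
section dops
variable {K B : Type} [Field K] [CommRing B] [Algebra K B]

/-- multiplication operator -/
def mu (K : Type) {B : Type} [Field K] [CommRing B] [Algebra K B] (b : B) : Module.End K B := Algebra.lmul K B b

@[simp] lemma mu_apply (a b : B) : mu K a b = a * b := rfl

lemma nc1 {R : Type*} [Ring R] (u v m : R) : u * v * m - m * (u * v) =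
      u * (v * m - m * v) + (u * m - m * u) * v := by noncomm_ring

lemma nc2 {R : Type*} [Ring R] (u r y : R) (h1 : r * y = y * r) (h2 : u * y = y * u) :
    (u * r - r * u) * y = y * (u * r - r * u) := by
  rw [sub_mul, mul_sub, mul_assoc, h1, ← mul_assoc, h2, mul_assoc, mul_assoc, h2, ← mul_assoc r, h1, mul_assoc]

lemma mem_D0 {u : Module.End K B} : u ∈ diffOpsLE K B 0 ↔ ∃ b, mu K b = u := Iff.rfl

lemma mem_Dsucc {i : ℕ} {u : Module.End K B} : u ∈ diffOpsLE K B (i + 1) ↔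
    ∀ r : B, u * mu K r - mu K r * u ∈ diffOpsLE K B i := by
  simp only [diffOpsLE, Submodule.mem_iInf]
  exact Iff.rfl

lemma mu_mul (a b : B) : mu K (a * b) = mu K a * mu K b := by
  ext; simp [mul_assoc]

lemma mu_comm (a b : B) : mu K a * mu K b = mu K b * mu K a := by
  rw [← mu_mul, ← mu_mul, mul_comm]

lemma D_le_succ (i : ℕ) : diffOpsLE K B i ≤ diffOpsLE K B (i + 1) := by
  induction i with
  | zero =>
    rintro u ⟨b, rfl⟩
    rw [mem_Dsucc]
    intro r
    change mu K b * mu K r - mu K r * mu K b ∈ _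
    rw [mu_comm, sub_self]; exact Submodule.zero_mem _
  | succ i ih =>
    intro u hu
    rw [mem_Dsucc] at hu ⊢
    exact fun r => ih (hu r)

lemma D_mono {i j : ℕ} (h : i ≤ j) : diffOpsLE K B i ≤ diffOpsLE K B j :=
  monotone_nat_of_le_succ D_le_succ h

lemma mem_D0_of_comm {u : Module.End K B} (h : ∀ r, u * mu K r = mu K r * u) :
    u ∈ diffOpsLE K B 0 := by
  refine ⟨u 1, ?_⟩
  ext b
  have := congrArg (fun f => f 1) (h b)
  simp at this
  change u 1 * b = u b
  rw [this, mul_comm]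

lemma D_mul {s : ℕ} : ∀ {i j : ℕ}, i + j = s → ∀ {u v : Module.End K B}, u ∈ diffOpsLE K B i →
    v ∈ diffOpsLE K B j → u * v ∈ diffOpsLE K B s := by
  induction s with
  | zero =>
    intro i j h u v hu hv
    obtain rfl : i = 0 := by omega
    obtain rfl : j = 0 := by omega
    obtain ⟨a, rfl⟩ := hu
    obtain ⟨b, rfl⟩ := hv
    exact ⟨a * b, mu_mul a b⟩
  | succ s ih =>
    intro i j h u v hu hv
    rw [mem_Dsucc]
    intro r
    have e : u * v * mu K r - mu K r * (u * v) =
      u * (v * mu K r - mu K r * v) + (u * mu K r - mu K r * u) * v := nc1 _ _ _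
    rw [e]
    apply Submodule.add_mem
    · cases j with
      | zero =>
        obtain ⟨b, rfl⟩ := hv
        change u * (mu K b * mu K r - mu K r * mu K b) ∈ _
        rw [mu_comm, sub_self, mul_zero]; exact Submodule.zero_mem _
      | succ j => exact ih (by omega) hu (mem_Dsucc.1 hv r)
    · cases i with
      | zero =>
        obtain ⟨b, rfl⟩ := hu
        change (mu K b * mu K r - mu K r * mu K b) * v ∈ _
        rw [mu_comm, sub_self, zero_mul]; exact Submodule.zero_mem _
      | succ i => exact ih (by omega) (mem_Dsucc.1 hu r) hv

lemma mem_diffOps_iff (u : Module.End K B) : u ∈ diffOps K B ↔ ∃ i, u ∈ diffOpsLE K B i := by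
  constructor
  · intro h
    induction h using Algebra.adjoin_induction with
    | mem x hx => simpa using hx
    | algebraMap r => exact ⟨0, algebraMap K B r, by ext; simp [Algebra.smul_def]⟩
    | add x y _ _ hx hy =>
      obtain ⟨i, hi⟩ := hx
      obtain ⟨j, hj⟩ := hy
      exact ⟨i + j, Submodule.add_mem _ (D_mono (by omega) hi) (D_mono (by omega) hj)⟩
    | mul x y _ _ hx hy =>
      obtain ⟨i, hi⟩ := hx
      obtain ⟨j, hj⟩ := hy
      exact ⟨i + j, D_mul rfl hi hj⟩
  · rintro ⟨i, hi⟩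
    exact Algebra.subset_adjoin (Set.mem_iUnion.2 ⟨i, hi⟩)

lemma deriv_mem (θ : Derivation K B B) : (θ : B →ₗ[K] B) ∈ diffOpsLE K B 1 := by
  rw [mem_Dsucc]
  intro r
  refine ⟨θ r, ?_⟩
  ext b
  change θ r * b = θ (r * b) - r * θ b
  simp [mul_comm]

/-- an operator commuting with multiplications by `y` is a multiplication operator -/
lemma V1 {n : ℕ} (y : Fin n → B)
    (hder : ∀ θ : Derivation K B B, (∀ i, θ (y i) = 0) → θ = 0) (c : ℕ) :
    ∀ u ∈ diffOpsLE K B c, (∀ i, u * mu K (y i) = mu K (y i) * u) → u ∈ diffOpsLE K B 0 := by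
  induction c with
  | zero => exact fun u h _ => h
  | succ c ih =>
    intro u hu hy
    have h0 : ∀ r, u * mu K r - mu K r * u ∈ diffOpsLE K B 0 := by
      intro r
      refine ih _ (mem_Dsucc.1 hu r) fun i => ?_
      exact nc2 _ _ _ (mu_comm (K := K) r (y i)) (hy i)
    choose d hd using h0
    have hd' : ∀ r b, d r * b = u (r * b) - r * u b := by
      intro r b
      have := congrArg (fun f => f b) (hd r)
      exact this
    let θ : Derivation K B B := Derivation.mk'
      { toFun := d
        map_add' := by
          intro a b
          have h1 := hd' (a + b) 1; have h2 := hd' a 1; have h3 := hd' b 1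
          simp only [mul_one, map_add] at h1 h2 h3
          rw [h1, h2, h3]; ring
        map_smul' := by
          intro k a
          have h1 := hd' (k • a) 1; have h2 := hd' a 1
          simp only [mul_one, map_smul] at h1 h2
          rw [h1, h2]; simp [smul_sub] } (by
        intro a b
        have h1 := hd' (a * b) 1; have h2 := hd' a b; have h3 := hd' b 1
        simp only [mul_one] at h1 h2 h3
        simp only [LinearMap.coe_mk, AddHom.coe_mk, smul_eq_mul]
        rw [h1, mul_comm b, h2, h3]; ring)
    have hθ : θ = 0 := by
      apply hder
      intro i
      have h1 := hd' (y i) 1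
      have h2 := congrArg (fun f => f 1) (hy i)
      simp at h1 h2
      change d (y i) = 0
      rw [h1, h2, sub_self]
    apply mem_D0_of_comm
    intro r
    rw [← sub_eq_zero, ← hd r]
    have : d r = θ r := rfl
    rw [this, hθ]; simp
end dops
end

section
section geomS

lemma der_zero {K B P : Type} [Field K] [CommRing B] [Algebra K B] [CommRing P] [IsDomain P] [CharZero P]
    [Algebra K P] [Algebra P B] [IsScalarTower K P B] [IsDomain B] [FaithfulSMul P B] [Algebra.IsAlgebraic P B]
    (θ : Derivation K B B) (h : ∀ p : P, θ (algebraMap P B p) = 0) : θ = 0 := by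
  let θ' : Derivation P B B := Derivation.mk'
    { toFun := θ
      map_add' := map_add θ
      map_smul' := by
        intro p b
        simp [Algebra.smul_def, h] } (by intro a b; simp)
  have hθ' : ∀ b, θ' b = θ b := fun _ => rfl
  ext b
  have key : ∀ d : ℕ, ∀ p : Polynomial P, p ≠ 0 → p.natDegree = d → Polynomial.aeval b p = 0 → θ b = 0 := by
    intro d
    induction d using Nat.strong_induction_on with
    | _ d ih =>
      intro p hp hd hpb
      have h1 : Polynomial.aeval b (Polynomial.derivative p) • θ' b = 0 := by
        rw [← Derivation.map_aeval, hpb, map_zero]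
      have hd0 : p.natDegree ≠ 0 := by
        intro h0
        rw [Polynomial.eq_C_of_natDegree_eq_zero h0] at hpb hp
        rw [Polynomial.aeval_C] at hpb
        have := (FaithfulSMul.algebraMap_injective P B) (hpb.trans (map_zero _).symm)
        exact hp (by rw [this, map_zero])
      rw [smul_eq_mul, mul_eq_zero] at h1
      rcases h1 with h1 | h1
      · refine ih _ ?_ (Polynomial.derivative p) ?_ rfl h1
        · rw [← hd]; exact Polynomial.natDegree_derivative_lt hd0
        · intro h0
          exact hd0 (Polynomial.derivative_eq_zero.1 h0)
      · exact h1
  obtain ⟨p, hp, hpb⟩ := Algebra.IsAlgebraic.isAlgebraic (R := P) b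
  exact key _ p hp rfl hpb

open TensorProduct in
lemma der_ext {K P F : Type} [Field K] [CommRing P] [Algebra K P] [Field F] [Algebra K F] [Algebra P F]
    [IsScalarTower K P F] [Algebra.FormallyEtale P F] (δ : Derivation K P F) :
    ∃ D : Derivation K F F, ∀ p, D (algebraMap P F p) = δ p := by
  let e := (KaehlerDifferential.tensorKaehlerEquivOfFormallyEtale K P F)
  let f : F ⊗[P] Ω[P⁄K] →ₗ[F] F := LinearMap.liftBaseChange F δ.liftKaehlerDifferential
  refine ⟨(f.comp e.symm.toLinearMap).compDer (KaehlerDifferential.D K F), fun p => ?_⟩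
  change f (e.symm (KaehlerDifferential.D K F (algebraMap P F p))) = _
  simp only [e]
  rw [KaehlerDifferential.tensorKaehlerEquivOfFormallyEtale_symm_D_algebraMap]
  simp [f]

lemma formEt {P B F : Type} [CommRing P] [IsDomain P] [CharZero P] [CommRing B] [IsDomain B] [Algebra P B]
    [FaithfulSMul P B] [Algebra.IsAlgebraic P B] [Field F] [Algebra B F] [IsFractionRing B F]
    [Algebra P F] [IsScalarTower P B F] : Algebra.FormallyEtale P F := by
  have hinj : Function.Injective (algebraMap P F) := by
    rw [IsScalarTower.algebraMap_eq P B F]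
    exact (IsFractionRing.injective B F).comp (FaithfulSMul.algebraMap_injective P B)
  have : FaithfulSMul P F := (faithfulSMul_iff_algebraMap_injective P F).2 hinj
  letI : Algebra (FractionRing P) F := FractionRing.liftAlgebra P F
  have : IsScalarTower P (FractionRing P) F := FractionRing.isScalarTower_liftAlgebra P F
  have : CharZero (FractionRing P) := charZero_of_injective_algebraMap (IsFractionRing.injective P (FractionRing P))
  have : Algebra.IsAlgebraic P F := by
    have : Algebra.IsAlgebraic B F := IsLocalization.isAlgebraic _ (nonZeroDivisors B)
    exact Algebra.IsAlgebraic.trans P B F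
  have : Algebra.IsAlgebraic (FractionRing P) F :=
    (IsFractionRing.comap_isAlgebraic_iff (A := P) (K := FractionRing P) (C := F)).1 this
  have : Algebra.FormallyEtale (FractionRing P) F := Algebra.FormallyEtale.of_isSeparable _ _
  have : Algebra.FormallyEtale P (FractionRing P) := Algebra.FormallyEtale.of_isLocalization (nonZeroDivisors P)
  exact Algebra.FormallyEtale.comp P (FractionRing P) F

lemma der_clear {K B F : Type} [Field K] [CommRing B] [IsDomain B] [Algebra K B] [Algebra.FiniteType K B] [Field F]
    [Algebra K F] [Algebra B F] [IsScalarTower K B F] [IsFractionRing B F] {s : ℕ}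
    (D : Fin s → Derivation K F F) : ∃ (g : B) (θ : Fin s → Derivation K B B), g ≠ 0 ∧
      ∀ i b, algebraMap B F (θ i b) = algebraMap B F g * D i (algebraMap B F b) := by
  obtain ⟨S, hS⟩ := (‹Algebra.FiniteType K B›).out
  obtain ⟨⟨g, hg⟩, hgS⟩ := IsLocalization.exist_integer_multiples_of_finite (nonZeroDivisors B)
    (fun p : Fin s × S => D p.1 (algebraMap B F p.2.1))
  have hint : ∀ i b, ∃ c : B, algebraMap B F c = algebraMap B F g * D i (algebraMap B F b) := by
    intro i b
    have hb : b ∈ Algebra.adjoin K (S : Set B) := by rw [hS]; trivial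
    induction hb using Algebra.adjoin_induction with
    | mem x hx =>
      obtain ⟨c, hc⟩ := hgS (i, ⟨x, hx⟩)
      exact ⟨c, by rw [hc]; simp [Algebra.smul_def]⟩
    | algebraMap r =>
      refine ⟨0, ?_⟩
      rw [← IsScalarTower.algebraMap_apply]; simp
    | add x y _ _ hx hy =>
      obtain ⟨c, hc⟩ := hx
      obtain ⟨d, hd⟩ := hy
      exact ⟨c + d, by rw [map_add, hc, hd, map_add, map_add, mul_add]⟩
    | mul x y _ _ hx hy =>
      obtain ⟨c, hc⟩ := hx
      obtain ⟨d, hd⟩ := hy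
      refine ⟨x * d + y * c, ?_⟩
      rw [map_add, map_mul, map_mul, hc, hd, map_mul, Derivation.leibniz, smul_eq_mul, smul_eq_mul]
      ring
  choose c hc using hint
  have inj := IsFractionRing.injective B F
  refine ⟨g, fun i => Derivation.mk'
    { toFun := c i
      map_add' := fun a b => inj (by rw [map_add, hc, hc, hc, map_add, map_add, mul_add])
      map_smul' := fun k a => inj (by
        rw [Algebra.smul_def, hc, map_mul, Derivation.leibniz, ← IsScalarTower.algebraMap_apply K B F,
          Derivation.map_algebraMap, RingHom.id_apply, Algebra.smul_def (A := B), map_mul, hc, ← IsScalarTower.algebraMap_apply K B F]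
        simp; ring) } ?_, nonZeroDivisors.ne_zero hg, hc⟩
  intro a b
  apply inj
  simp only [LinearMap.coe_mk, AddHom.coe_mk, smul_eq_mul, map_add, map_mul, hc, Derivation.leibniz]
  ring

lemma dim_le_of_int {P B : Type} [CommRing P] [CommRing B] [Algebra P B] [FaithfulSMul P B]
    [Algebra.IsIntegral P B] : ringKrullDim P ≤ ringKrullDim B := by
  unfold ringKrullDim
  apply iSup_le
  intro l
  obtain ⟨⟨Q, hQ, hl⟩⟩ := Ideal.nonempty_primesOver (S := B) (RelSeries.head l).asIdeal
  have : Algebra.HasGoingUp P B := Algebra.HasGoingUp.of_isIntegral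
  obtain ⟨l', hl', _⟩ := Ideal.exists_ltSeries_of_hasGoingUp l Q
  rw [← hl']
  exact Order.LTSeries.length_le_krullDim l'

theorem geom (K B : Type) [Field K] [CharZero K] [CommRing B] [Algebra K B] [IsDomain B]
    [Algebra.FiniteType K B] (n : ℕ) (hn : 0 < n) (hdim : ringKrullDim B = (n : WithBot (WithTop ℕ))) :
    ∃ s, 0 < s ∧ s ≤ n ∧ ∃ (y : Fin s → B) (t : ℕ) (b : Fin t → B) (g : B) (θ : Fin s → Derivation K B B),
      g ≠ 0 ∧ (∀ i j, θ i (y j) = if i = j then g else 0) ∧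
      (∀ x : B, ∃ q : Fin t → B, (∀ j, q j ∈ Algebra.adjoin K (Set.range y)) ∧ x = ∑ j, q j * b j) ∧
      (∀ x : B, x ≠ 0 → ∃ z, x * z ≠ 0 ∧ x * z ∈ Algebra.adjoin K (Set.range y)) ∧
      (∀ θ : Derivation K B B, (∀ i, θ (y i) = 0) → θ = 0) := by
  have hdim : ringKrullDim B = (n : WithBot ℕ∞) := hdim
  obtain ⟨s, f, hf, hfin⟩ := exists_finite_inj_algHom_of_fg K B
  letI : Algebra (MvPolynomial (Fin s) K) B := f.toRingHom.toAlgebra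
  have hfa : ∀ p, algebraMap (MvPolynomial (Fin s) K) B p = f p := fun _ => rfl
  have : IsScalarTower K (MvPolynomial (Fin s) K) B := IsScalarTower.of_algebraMap_eq (fun k => by
    rw [hfa]; exact (f.commutes k).symm)
  have : Module.Finite (MvPolynomial (Fin s) K) B := hfin
  have : FaithfulSMul (MvPolynomial (Fin s) K) B := (faithfulSMul_iff_algebraMap_injective _ _).2 hf
  have : CharZero (MvPolynomial (Fin s) K) := charZero_of_injective_algebraMap (FaithfulSMul.algebraMap_injective K _)
  have hd1 : ringKrullDim (MvPolynomial (Fin s) K) = s := by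
    rw [MvPolynomial.ringKrullDim_of_isNoetherianRing]; simp
  have hd2 := dim_le_of_int (P := MvPolynomial (Fin s) K) (B := B)
  rw [hd1, hdim] at hd2
  have hadj : ∀ p, f p ∈ Algebra.adjoin K (Set.range fun i => f (MvPolynomial.X i)) := by
    intro p
    rw [Algebra.adjoin_range_eq_range_aeval]
    refine ⟨p, ?_⟩
    change MvPolynomial.aeval (fun i => f (MvPolynomial.X i)) p = f p
    rw [← MvPolynomial.comp_aeval_apply]; simp
  refine ⟨s, ?_, by exact_mod_cast hd2, fun i => f (MvPolynomial.X i), ?_⟩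
  · rcases Nat.eq_zero_or_pos s with rfl | h
    · exfalso
      have : IsField (MvPolynomial (Fin 0) K) :=
        MulEquiv.isField (Field.toIsField K) (MvPolynomial.isEmptyRingEquiv K (Fin 0)).toMulEquiv
      have := isField_of_isIntegral_of_isField' (S := B) this
      rw [ringKrullDim_eq_zero_of_isField this] at hdim
      have : (0 : ℕ) = n := by exact_mod_cast hdim
      omega
    · exact h
  obtain ⟨t, b, hb⟩ := Module.Finite.exists_fin (R := MvPolynomial (Fin s) K) (M := B)
  have := formEt (P := MvPolynomial (Fin s) K) (B := B) (F := FractionRing B)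
  choose D hD using fun i : Fin s => der_ext (K := K) (P := MvPolynomial (Fin s) K) (F := FractionRing B)
    (MvPolynomial.mkDerivation K (Pi.single i 1))
  obtain ⟨g, θ, hg, hθ⟩ := der_clear (B := B) D
  refine ⟨t, b, g, θ, hg, ?_, ?_, ?_, ?_⟩
  · intro i j
    apply IsFractionRing.injective B (FractionRing B)
    rw [hθ]
    change _ * (D i) (algebraMap B (FractionRing B) (algebraMap (MvPolynomial (Fin s) K) B (MvPolynomial.X j))) = _
    rw [← IsScalarTower.algebraMap_apply, hD, MvPolynomial.mkDerivation_X]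
    by_cases h : i = j
    · subst h; simp
    · simp [h]
  · intro x
    have hx : x ∈ Submodule.span (MvPolynomial (Fin s) K) (Set.range b) := by rw [hb]; trivial
    rw [Submodule.mem_span_range_iff_exists_fun] at hx
    obtain ⟨c, hc⟩ := hx
    refine ⟨fun j => f (c j), fun j => hadj _, ?_⟩
    rw [← hc]; rfl
  · intro x hx
    obtain ⟨r, hr, z, hz⟩ := (Algebra.IsAlgebraic.isAlgebraic (R := MvPolynomial (Fin s) K) x).exists_nonzero_dvd
      (mem_nonZeroDivisors_of_ne_zero hx)
    refine ⟨z, ?_, ?_⟩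
    · rw [← hz, hfa]; intro h; exact hr (hf (h.trans (map_zero f).symm))
    · rw [← hz]; exact hadj r
  · intro θ h
    apply der_zero (P := MvPolynomial (Fin s) K) θ
    have : θ.compAlgebraMap (MvPolynomial (Fin s) K) = 0 := by
      apply MvPolynomial.derivation_ext
      intro i
      exact h i
    intro p
    have := congrArg (fun d => d p) this
    exact this
end geomS
end

section
section asm

structure WS {K B R E : Type} [Field K] [CommRing B] [Algebra K B] [Ring R] [Algebra K R]
    [DivisionRing E] [Algebra K E] {n : ℕ} (m : B →ₐ[K] R) (ι : R →ₐ[K] E) (y : Fin n → B) (g : B)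
    (T : Fin n → B → B) (θ : Fin n → R) : Prop where
  hm : Function.Injective m
  hi : Function.Injective ι
  hg : g ≠ 0
  hθ : ∀ i b, θ i * m b = m b * θ i + m (T i b)
  hT : ∀ i j, T i (y j) = if i = j then g else 0
  hω : ∀ i j, m g * θ i * θ j - m (T i g) * θ j = m g * θ j * θ i - m (T j g) * θ i
  nil : ∀ (u : R) (k : Fin n), ∃ c : ℕ, (fun v => v * m (y k) - m (y k) * v)^[c] u = 0
  v1 : ∀ u : R, (∀ k, u * m (y k) = m (y k) * u) → ∃ b, u = m b

lemma nc3 {E : Type*} [DivisionRing E] {G A1 A2 t1 : E} (hG : G ≠ 0) (h1 : A1 * G = G * A1 + t1)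
    (hc : t1 * G = G * t1) :
    G⁻¹ * A1 * (G⁻¹ * A2) = G⁻¹ * G⁻¹ * G⁻¹ * (G * A1 * A2 - t1 * A2) := by
  have h2 : A1 * G⁻¹ = G⁻¹ * A1 - G⁻¹ * G⁻¹ * t1 := by
    have : A1 = (G * A1 + t1) * G⁻¹ := by rw [← h1, mul_inv_cancel_right₀ hG]
    have h3 : t1 * G⁻¹ = G⁻¹ * t1 := by
      rw [mul_inv_eq_iff_eq_mul₀ hG, mul_assoc, hc, inv_mul_cancel_left₀ hG]
    calc A1 * G⁻¹ = G⁻¹ * (G * A1 + t1 - t1) * G⁻¹ := by rw [add_sub_cancel_right, inv_mul_cancel_left₀ hG]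
      _ = G⁻¹ * ((G * A1 + t1) * G⁻¹) - G⁻¹ * (t1 * G⁻¹) := by rw [mul_sub, sub_mul, mul_assoc, mul_assoc]
      _ = _ := by rw [← this, h3, mul_assoc]
  calc G⁻¹ * A1 * (G⁻¹ * A2) = G⁻¹ * (A1 * G⁻¹) * A2 := by simp only [mul_assoc]
    _ = G⁻¹ * (G⁻¹ * A1 - G⁻¹ * G⁻¹ * t1) * A2 := by rw [h2]
    _ = G⁻¹ * (G⁻¹ * (G⁻¹ * G) * A1 - G⁻¹ * G⁻¹ * t1) * A2 := by rw [inv_mul_cancel₀ hG, mul_one]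
    _ = _ := by noncomm_ring

variable {K B R E : Type} [Field K] [CommRing B] [IsDomain B] [Algebra K B] [Ring R] [Algebra K R]
    [DivisionRing E] [Algebra K E] {n : ℕ} {m : B →ₐ[K] R} {ι : R →ₐ[K] E} {y : Fin n → B} {g : B}
    {T : Fin n → B → B} {θ : Fin n → R}

/-- the embedding of `B` -/
def jj (m : B →ₐ[K] R) (ι : R →ₐ[K] E) (b : B) : E := ι (m b)
/-- the partial derivatives -/
def Dd (m : B →ₐ[K] R) (ι : R →ₐ[K] E) (g : B) (θ : Fin n → R) (i : Fin n) : E :=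
  (jj m ι g)⁻¹ * ι (θ i)

lemma jj_comm (a b : B) : jj m ι a * jj m ι b = jj m ι b * jj m ι a := by
  unfold jj; rw [← map_mul, ← map_mul, mul_comm, map_mul, map_mul]
lemma jj_mul (a b : B) : jj m ι (a * b) = jj m ι a * jj m ι b := by
  unfold jj; rw [map_mul, map_mul]

lemma jj_ne (W : WS m ι y g T θ) {b : B} (hb : b ≠ 0) : jj m ι b ≠ 0 := by
  unfold jj
  intro h
  exact hb (W.hm ((W.hi (h.trans (map_zero ι).symm)).trans (map_zero m).symm))

lemma th_jj (W : WS m ι y g T θ) (i : Fin n) (b : B) : ι (θ i) * jj m ι b = jj m ι b * ι (θ i) + jj m ι (T i b) := by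
  unfold jj; rw [← map_mul, W.hθ, map_add, map_mul]

lemma W1 (W : WS m ι y g T θ) (i j : Fin n) : Dd m ι g θ i * jj m ι (y j) - jj m ι (y j) * Dd m ι g θ i =
    if i = j then 1 else 0 := by
  have hG := jj_ne W W.hg
  have h3 : jj m ι (y j) * (jj m ι g)⁻¹ = (jj m ι g)⁻¹ * jj m ι (y j) := by
    rw [mul_inv_eq_iff_eq_mul₀ hG, mul_assoc, jj_comm, inv_mul_cancel_left₀ hG]
  unfold Dd
  rw [mul_assoc, th_jj W, ← mul_assoc, h3, mul_add, mul_assoc, add_sub_cancel_left, W.hT]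
  split_ifs
  · exact inv_mul_cancel₀ hG
  · simp [jj]

lemma W2 (W : WS m ι y g T θ) (i j : Fin n) : Dd m ι g θ i * Dd m ι g θ j = Dd m ι g θ j * Dd m ι g θ i := by
  have hG := jj_ne W W.hg
  unfold Dd
  rw [nc3 hG (th_jj W i g) (jj_comm (T i g) g), nc3 hG (th_jj W j g) (jj_comm (T j g) g)]
  congr 1
  have := congrArg ι (W.hω i j)
  simpa [jj] using this

/-- commutator with `y k` -/
def ad (m : B →ₐ[K] R) (ι : R →ₐ[K] E) (y : Fin n → B) (k : Fin n) (e : E) : E :=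
  e * jj m ι (y k) - jj m ι (y k) * e

/-- fractions with denominators in `B` -/
def FF (m : B →ₐ[K] R) (ι : R →ₐ[K] E) : Set E := {e | ∃ b ≠ 0, ∃ u, jj m ι b * e = ι u}

lemma FF_add {e f : E} (he : e ∈ FF m ι) (hf : f ∈ FF m ι) : e + f ∈ FF m ι := by
  obtain ⟨b, hb, u, hu⟩ := he
  obtain ⟨c, hc, v, hv⟩ := hf
  refine ⟨b * c, mul_ne_zero hb hc, m c * u + m b * v, ?_⟩
  have h1 : ι (m c * u) = jj m ι c * (jj m ι b * e) := by rw [map_mul, hu]; rfl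
  have h2 : ι (m b * v) = jj m ι b * (jj m ι c * f) := by rw [map_mul, hv]; rfl
  rw [map_add, h1, h2, mul_add, jj_mul, ← mul_assoc, jj_comm c b, ← mul_assoc]

lemma FF_mul_left {e : E} (a : B) (he : e ∈ FF m ι) : jj m ι a * e ∈ FF m ι := by
  obtain ⟨b, hb, u, hu⟩ := he
  refine ⟨b, hb, m a * u, ?_⟩
  rw [map_mul, ← hu, ← mul_assoc, jj_comm b a, mul_assoc]; rfl

lemma FF_mul_right {e : E} (v : R) (he : e ∈ FF m ι) : e * ι v ∈ FF m ι := by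
  obtain ⟨b, hb, u, hu⟩ := he
  exact ⟨b, hb, u * v, by rw [map_mul, ← hu, mul_assoc]⟩

lemma FF_neg {e : E} (he : e ∈ FF m ι) : -e ∈ FF m ι := by
  obtain ⟨b, hb, u, hu⟩ := he
  exact ⟨b, hb, -u, by rw [map_neg, ← hu, mul_neg]⟩

lemma FF_smul {e : E} (k : K) (he : e ∈ FF m ι) : k • e ∈ FF m ι := by
  obtain ⟨b, hb, u, hu⟩ := he
  exact ⟨b, hb, k • u, by rw [map_smul, ← hu, mul_smul_comm]⟩

lemma FF_sub {e f : E} (he : e ∈ FF m ι) (hf : f ∈ FF m ι) : e - f ∈ FF m ι := by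
  rw [sub_eq_add_neg]; exact FF_add he (FF_neg hf)

lemma FF_ad {e : E} (k : Fin n) (he : e ∈ FF m ι) : ad m ι y k e ∈ FF m ι :=
  FF_sub (FF_mul_right _ he) (FF_mul_left _ he)

lemma FF_D (W : WS m ι y g T θ) {e : E} (i : Fin n) (he : e ∈ FF m ι) : Dd m ι g θ i * e ∈ FF m ι := by
  obtain ⟨b, hb, u, hu⟩ := he
  refine ⟨b * b * g, mul_ne_zero (mul_ne_zero hb hb) W.hg, m b * θ i * u - m (T i b) * u, ?_⟩
  have h1 := th_jj W i b
  have h2 : ι (m b * θ i * u - m (T i b) * u) =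
      jj m ι b * (ι (θ i) * jj m ι b) * e - jj m ι (T i b) * jj m ι b * e := by
    rw [map_sub, map_mul, map_mul, map_mul, ← hu]; simp only [mul_assoc]; rfl
  rw [h2, h1, jj_comm (T i b) b, jj_mul, jj_mul]
  unfold Dd
  have hG := jj_ne W W.hg
  calc _ = jj m ι b * jj m ι b * (jj m ι g * (jj m ι g)⁻¹) * ι (θ i) * e := by simp only [mul_assoc]
    _ = jj m ι b * jj m ι b * ι (θ i) * e := by rw [mul_inv_cancel₀ hG, mul_one]
    _ = _ := by noncomm_ring

lemma ad_jj (k : Fin n) (b : B) (e : E) : ad m ι y k (jj m ι b * e) = jj m ι b * ad m ι y k e := by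
  unfold ad
  rw [mul_sub, ← mul_assoc (jj m ι (y k)), jj_comm (y k) b]; simp only [mul_assoc]

lemma ad_iter_jj (k : Fin n) (b : B) (e : E) (c : ℕ) :
    (ad m ι y k)^[c] (jj m ι b * e) = jj m ι b * (ad m ι y k)^[c] e := by
  induction c generalizing e with
  | zero => rfl
  | succ c ih => rw [Function.iterate_succ_apply, Function.iterate_succ_apply, ad_jj, ih]

lemma ad_iter_i (k : Fin n) (u : R) (c : ℕ) :
    (ad m ι y k)^[c] (ι u) = ι ((fun v => v * m (y k) - m (y k) * v)^[c] u) := by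
  induction c generalizing u with
  | zero => rfl
  | succ c ih =>
    rw [Function.iterate_succ_apply, Function.iterate_succ_apply, ← ih]
    congr 1
    simp [ad, jj]

lemma FF_nil (W : WS m ι y g T θ) {e : E} (k : Fin n) (he : e ∈ FF m ι) :
    ∃ c, (ad m ι y k)^[c] e = 0 := by
  obtain ⟨b, hb, u, hu⟩ := he
  obtain ⟨c, hc⟩ := W.nil u k
  refine ⟨c, ?_⟩
  have := ad_iter_i (m := m) (ι := ι) (y := y) k u c
  rw [hc, ← hu, ad_iter_jj, map_zero] at this
  exact (mul_eq_zero.1 this).resolve_left (jj_ne W hb)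

lemma FF_comm (W : WS m ι y g T θ) {e : E} (he : e ∈ FF m ι) (h : ∀ k, ad m ι y k e = 0) :
    ∃ b ≠ 0, ∃ b', jj m ι b * e = jj m ι b' := by
  obtain ⟨b, hb, u, hu⟩ := he
  obtain ⟨b', rfl⟩ := W.v1 u (by
    intro k
    apply W.hi
    have := ad_jj (m := m) (ι := ι) (y := y) k b e
    rw [h, hu, mul_zero] at this
    rw [map_mul, map_mul]
    exact sub_eq_zero.1 this)
  exact ⟨b, hb, b', hu⟩

lemma ad_zero (k : Fin n) : ad m ι y k 0 = 0 := by simp [ad]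
lemma ad_sub (k : Fin n) (e f : E) : ad m ι y k (e - f) = ad m ι y k e - ad m ι y k f := by
  simp only [ad, sub_mul, mul_sub]; abel
lemma ad_smul (k : Fin n) (c : K) (e : E) : ad m ι y k (c • e) = c • ad m ι y k e := by
  simp only [ad, smul_sub, smul_mul_assoc, mul_smul_comm]
lemma ad_ad (k l : Fin n) (e : E) : ad m ι y k (ad m ι y l e) = ad m ι y l (ad m ι y k e) := by
  have := jj_comm (m := m) (ι := ι) (y k) (y l)
  simp only [ad, sub_mul, mul_sub]
  rw [mul_assoc e, mul_assoc e, this, ← mul_assoc (jj m ι (y k)) (jj m ι (y l)), this]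
  simp only [mul_assoc]
  abel

lemma ad_D (W : WS m ι y g T θ) (k l : Fin n) (e : E) :
    ad m ι y k (Dd m ι g θ l * e) = Dd m ι g θ l * ad m ι y k e + if l = k then e else 0 := by
  have := W1 W l k
  have h2 : (if l = k then e else 0) = (if l = k then (1 : E) else 0) * e := by split_ifs <;> simp
  rw [h2, ← this]
  simp only [ad]
  noncomm_ring

lemma ad_iter_zero (k : Fin n) (c : ℕ) : (ad m ι y k)^[c] 0 = 0 := by
  induction c with
  | zero => rfl
  | succ c ih => rw [Function.iterate_succ_apply, ad_zero, ih]
lemma ad_iter_sub (k : Fin n) (c : ℕ) (e f : E) :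
    (ad m ι y k)^[c] (e - f) = (ad m ι y k)^[c] e - (ad m ι y k)^[c] f := by
  induction c generalizing e f with
  | zero => rfl
  | succ c ih => simp only [Function.iterate_succ_apply, ad_sub, ih]
lemma ad_iter_smul (k : Fin n) (c : ℕ) (a : K) (e : E) :
    (ad m ι y k)^[c] (a • e) = a • (ad m ι y k)^[c] e := by
  induction c generalizing e with
  | zero => rfl
  | succ c ih => simp only [Function.iterate_succ_apply, ad_smul, ih]

lemma ad_iter_D (W : WS m ι y g T θ) (k : Fin n) (c : ℕ) (e : E) :
    (ad m ι y k)^[c + 1] (Dd m ι g θ k * e) = Dd m ι g θ k * (ad m ι y k)^[c + 1] e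
      + ((c + 1 : ℕ) : K) • (ad m ι y k)^[c] e := by
  induction c with
  | zero => simp [ad_D W]
  | succ c ih =>
    rw [Function.iterate_succ_apply', ih]
    have hadd : ∀ e f : E, ad m ι y k (e + f) = ad m ι y k e + ad m ι y k f := by
      intro e f; simp only [ad, add_mul, mul_add]; abel
    rw [hadd, ad_D W, ad_smul, Function.iterate_succ_apply' _ (c + 1), Function.iterate_succ_apply' _ c, if_pos rfl]
    push_cast
    rw [add_smul (_ + 1 : K) 1, one_smul, add_assoc]
    congr 1
    rw [add_comm]

lemma struct_aux [CharZero K] (W : WS m ι y g T θ) (S : Set E) (hadd : ∀ e ∈ S, ∀ f ∈ S, e + f ∈ S)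
    (h0 : (0 : E) ∈ S)
    (hD : ∀ (c : K) i, ∀ e ∈ S, c • (Dd m ι g θ i * e) ∈ S)
    (hF0 : ∀ e, (∃ b ≠ 0, ∃ b', jj m ι b * e = jj m ι b') → e ∈ S) (d : ℕ) :
    ∀ e ∈ FF m ι, (∀ i : Fin n, d ≤ i.1 → ad m ι y i e = 0) → e ∈ S := by
  induction d with
  | zero => exact fun e he h => hF0 e (FF_comm W he (fun k => h k (Nat.zero_le _)))
  | succ d ih =>
    intro e he h
    by_cases hd : d < n
    · let k : Fin n := ⟨d, hd⟩
      obtain ⟨c, hc⟩ := FF_nil W k he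
      induction c generalizing e with
      | zero =>
        have : e = 0 := hc
        rw [this]; exact h0
      | succ c ihc =>
        rcases c with _ | c
        · refine ih e he fun i hi => ?_
          rcases Nat.eq_or_lt_of_le hi with hi | hi
          · have : i = k := Fin.ext hi.symm
            rw [this]; exact hc
          · exact h i hi
        · have hcz : ((c + 1 : ℕ) : K) ≠ 0 := by exact_mod_cast Nat.succ_ne_zero c
          set x := ad m ι y k e with hx
          have hxF : x ∈ FF m ι := FF_ad k he
          have hxh : ∀ i : Fin n, d + 1 ≤ i.1 → ad m ι y i x = 0 := by
            intro i hi
            rw [hx, ad_ad, h i hi, ad_zero]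
          have hxc : (ad m ι y k)^[c + 1] x = 0 := hc
          have hxS : x ∈ S := ihc x hxF hxh hxc
          have hDx := ad_iter_D W k c x
          rw [hxc, mul_zero, zero_add] at hDx
          have e1S : e - (((c + 1 : ℕ) : K)⁻¹ • (Dd m ι g θ k * x)) ∈ S := by
            apply ihc
            · exact FF_sub he (FF_smul _ (FF_D W k hxF))
            · intro i hi
              have hki : k ≠ i := by
                intro h; rw [← h] at hi; simp [k] at hi
              rw [ad_sub, h i hi, ad_smul, ad_D W, hxh i hi, if_neg hki]; simp
            · rw [ad_iter_sub, ad_iter_smul, hDx, smul_smul, inv_mul_cancel₀ hcz, one_smul, hx,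
                ← Function.iterate_succ_apply, sub_self]
          have := hadd _ e1S _ (hD ((c + 1 : ℕ) : K)⁻¹ k x hxS)
          rwa [sub_add_cancel] at this
    · exact ih e he fun i hi => absurd i.2 (by omega)

lemma struct [CharZero K] (W : WS m ι y g T θ) (S : Set E) (hadd : ∀ e ∈ S, ∀ f ∈ S, e + f ∈ S)
    (h0 : (0 : E) ∈ S)
    (hD : ∀ (c : K) i, ∀ e ∈ S, c • (Dd m ι g θ i * e) ∈ S)
    (hF0 : ∀ e, (∃ b ≠ 0, ∃ b', jj m ι b * e = jj m ι b') → e ∈ S) (u : R) : ι u ∈ S :=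
  struct_aux W S hadd h0 hD hF0 n (ι u) ⟨1, one_ne_zero, u, by simp [jj]⟩
    (fun i hi => absurd i.2 (by omega))
end asm
end

section
section fin

lemma all_in {K E R : Type} [Field K] [CharZero K] [DivisionRing E] [Algebra K E] [Ring R]
    (ι : R →+* E) (hi : Function.Injective ι)
    (hfrac : ∀ x : E, ∃ s a : R, s ≠ 0 ∧ ι s * x = ι a)
    (A : Subalgebra K E) {N : ℕ} {Z : Fin N → A} (hgen : Algebra.adjoin K (Set.range Z) = ⊤)
    (hZ : ∀ a b, ∃ c : ℤ, Z a * Z b - Z b * Z a = c) (hW : WeylRel Z)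
    (ho : ∀ a b : A, b ≠ 0 → ∃ s a' : A, s ≠ 0 ∧ s * a = a' * b) {t : ℕ} (b : Fin t → E)
    (hR : ∀ u, ι u ∈ clos ho (Submodule.span A (Set.range b))) (x : E) :
    x ∈ clos ho (Submodule.span A (Set.range b)) := by
  classical
  obtain ⟨ρ, ⟨u, hu⟩, hρ2⟩ : ∃ ρ, (∃ v : Fin ρ → R, LinearIndependent A (fun j => ι (v j))) ∧
      ∀ v : Fin (ρ + 1) → R, ¬ LinearIndependent A (fun j => ι (v j)) := by
    by_contra hcon
    push Not at hcon
    have : ∀ ρ, ∃ v : Fin ρ → R, LinearIndependent A (fun j => ι (v j)) := by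
      intro ρ
      induction ρ with
      | zero => exact ⟨fun j => j.elim0, linearIndependent_empty_type⟩
      | succ k ih => exact hcon k ih
    obtain ⟨v, hv⟩ := this (t + 1)
    have := rank_clos (K := K) hgen hZ hW b _ hv ho (fun j => hR _)
    omega
  obtain ⟨s, a, hs, hsa⟩ := hfrac x
  have hs' : ι s ≠ 0 := fun h => hs (hi (h.trans (map_zero ι).symm))
  have h1 : LinearIndependent A (fun j => ι (u j * s)) := by
    rw [Fintype.linearIndependent_iff] at hu ⊢
    intro c hc
    apply hu
    have : (∑ j, c j • ι (u j)) * ι s = 0 := by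
      rw [← hc, Finset.sum_mul]
      refine Finset.sum_congr rfl fun j _ => ?_
      rw [map_mul, smul_mul_assoc]
    exact (mul_eq_zero.1 this).resolve_right hs'
  have h2 : ¬ LinearIndependent A (Fin.cons 1 (fun j => ι (u j * s)) : Fin (ρ + 1) → E) := by
    intro h
    apply hρ2 (Fin.cons 1 (fun j => u j * s))
    convert h using 1
    funext j
    refine Fin.cases ?_ (fun j => ?_) j <;> simp
  have h3 : ∃ (c : A) (z : E), z ∈ Submodule.span A (Set.range (fun j => ι (u j * s))) ∧
      c • (1 : E) + z = 0 ∧ c ≠ 0 := by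
    by_contra hcon
    push Not at hcon
    exact h2 (LinearIndependent.finCons' _ _ h1 hcon)
  obtain ⟨c, z, hz, hcz, hc⟩ := h3
  refine clos_clos ho _ x c hc ?_
  rw [Submodule.mem_span_range_iff_exists_fun] at hz
  obtain ⟨d, rfl⟩ := hz
  have : c • x = - ∑ j, d j • ι (u j * a) := by
    have e : (c • (1 : E) + ∑ j, d j • ι (u j * s)) * x = 0 := by rw [hcz, zero_mul]
    rw [add_mul, Finset.sum_mul, smul_mul_assoc, one_mul] at e
    rw [eq_neg_iff_add_eq_zero, ← e]
    congr 1
    refine Finset.sum_congr rfl fun j _ => ?_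
    rw [smul_mul_assoc, map_mul, map_mul, mul_assoc, hsa]
  rw [this]
  exact neg_mem (Submodule.sum_mem _ fun j _ => Submodule.smul_mem _ _ (hR _))

variable {K B R E : Type} [Field K] [CommRing B] [IsDomain B] [Algebra K B] [Ring R] [Algebra K R]
    [DivisionRing E] [Algebra K E] {n : ℕ} {m : B →ₐ[K] R} {ι : R →ₐ[K] E} {y : Fin n → B} {g : B}
    {T : Fin n → B → B} {θ : Fin n → R}

/-- Weyl generators -/
def Zz (m : B →ₐ[K] R) (ι : R →ₐ[K] E) (y : Fin n → B) (g : B) (θ : Fin n → R) : Fin (n + n) → E :=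
  Fin.addCases (fun i => jj m ι (y i)) (fun i => Dd m ι g θ i)

lemma Zz_l (i : Fin n) : Zz m ι y g θ (Fin.castAdd n i) = jj m ι (y i) := by simp [Zz]
lemma Zz_r (i : Fin n) : Zz m ι y g θ (Fin.natAdd n i) = Dd m ι g θ i := by
  unfold Zz; exact Fin.addCases_right i

lemma Zz_weyl (W : WS m ι y g T θ) : WeylRel (Zz m ι y g θ) := by
  intro a
  refine Fin.addCases (fun i => ?_) (fun i => ?_) a
  · refine ⟨Fin.natAdd n i, 1, one_ne_zero, fun b => ?_⟩
    refine Fin.addCases (fun j => ?_) (fun j => ?_) b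
    · rw [Zz_l, Zz_r, W1 W]
      simp [eq_comm]
    · rw [Zz_r, Zz_r, W2 W, sub_self, if_neg]
      intro h
      have := congrArg Fin.val h
      simp at this; omega
  · refine ⟨Fin.castAdd n i, -1, by norm_num, fun b => ?_⟩
    refine Fin.addCases (fun j => ?_) (fun j => ?_) b
    · rw [Zz_l, Zz_l, jj_comm, sub_self, if_neg]
      intro h
      have := congrArg Fin.val h
      simp at this; omega
    · rw [Zz_l, Zz_r, ← neg_sub, W1 W]
      by_cases h : j = i
      · simp [h]
      · simp [h]

lemma Zz_comm (W : WS m ι y g T θ) (a b : Fin (n + n)) :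
    ∃ c : ℤ, Zz m ι y g θ a * Zz m ι y g θ b - Zz m ι y g θ b * Zz m ι y g θ a = c := by
  refine Fin.addCases (fun i => ?_) (fun i => ?_) a <;>
    refine Fin.addCases (fun j => ?_) (fun j => ?_) b
  · exact ⟨0, by rw [Zz_l, Zz_l, jj_comm, sub_self, Int.cast_zero]⟩
  · refine ⟨if j = i then -1 else 0, ?_⟩
    rw [Zz_l, Zz_r, ← neg_sub, W1 W]
    split_ifs <;> simp
  · refine ⟨if i = j then 1 else 0, ?_⟩
    rw [Zz_l, Zz_r, W1 W]
    split_ifs <;> simp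
  · exact ⟨0, by rw [Zz_r, Zz_r, W2 W, sub_self, Int.cast_zero]⟩

theorem abstract_main [CharZero K] (W : WS m ι y g T θ) (hn : 0 < n)
    (hfrac : ∀ x : E, ∃ s a : R, s ≠ 0 ∧ ι s * x = ι a) {t : ℕ} (b : Fin t → B)
    (hgenB : ∀ x, ∃ q : Fin t → B, (∀ j, q j ∈ Algebra.adjoin K (Set.range y)) ∧
      x = ∑ j, q j * b j)
    (hdiv : ∀ x : B, x ≠ 0 → ∃ z, x * z ≠ 0 ∧ x * z ∈ Algebra.adjoin K (Set.range y))
    {L : Type} [Field L] [Algebra K L] (gl : L →ₐ[K] E) {M : ℕ} (x : Fin M → L)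
    (hx : AlgebraicIndependent K x) : M ≤ n := by
  classical
  set A : Subalgebra K E := Algebra.adjoin K (Set.range (Zz m ι y g θ)) with hA
  let ZA : Fin (n + n) → A := fun a => ⟨Zz m ι y g θ a, Algebra.subset_adjoin ⟨a, rfl⟩⟩
  have hgen : Algebra.adjoin K (Set.range ZA) = ⊤ := by
    apply Subalgebra.map_injective (f := A.val) Subtype.val_injective
    rw [AlgHom.map_adjoin, Algebra.map_top, Subalgebra.range_val, ← Set.range_comp]
    rfl
  have hZ : ∀ a b, ∃ c : ℤ, ZA a * ZA b - ZA b * ZA a = c := by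
    intro a b
    obtain ⟨c, hc⟩ := Zz_comm W a b
    exact ⟨c, Subtype.ext (by push_cast; exact hc)⟩
  have hW : WeylRel ZA := by
    intro a
    obtain ⟨a', ε, h1, h2⟩ := Zz_weyl W a
    refine ⟨a', ε, h1, fun b => Subtype.ext ?_⟩
    have := h2 b
    by_cases h : b = a
    · rw [if_pos h] at this ⊢; push_cast; exact this
    · rw [if_neg h] at this ⊢; push_cast; exact this
  have ho := ore_of (K := K) hgen hZ hW
  have hjA : ∀ q ∈ Algebra.adjoin K (Set.range y), jj m ι q ∈ A := by
    intro q hq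
    have : Algebra.adjoin K (Set.range y) ≤ A.comap (ι.comp m) := by
      rw [Algebra.adjoin_le_iff]
      rintro _ ⟨i, rfl⟩
      have := (ZA (Fin.castAdd n i)).2
      simp only [ZA, Zz_l] at this
      exact this
    exact this hq
  have hDA : ∀ i, Dd m ι g θ i ∈ A := by
    intro i
    have := (ZA (Fin.natAdd n i)).2
    simp only [ZA, Zz_r] at this
    exact this
  have hjspan : ∀ c : B, jj m ι c ∈ Submodule.span A (Set.range fun j => jj m ι (b j)) := by
    intro c
    obtain ⟨q, hq, rfl⟩ := hgenB c
    have : jj m ι (∑ j, q j * b j) = ∑ j, (⟨jj m ι (q j), hjA _ (hq j)⟩ : A) • jj m ι (b j) := by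
      simp only [jj, map_sum, map_mul]
      rfl
    rw [this]
    exact Submodule.sum_mem _ fun j _ => Submodule.smul_mem _ _ (Submodule.subset_span ⟨j, rfl⟩)
  have hS : ∀ u : R, ι u ∈ clos ho (Submodule.span A (Set.range fun j => jj m ι (b j))) := by
    intro u
    refine struct W (clos ho (Submodule.span A (Set.range fun j => jj m ι (b j))) : Set E)
      (fun e he f hf => Submodule.add_mem _ he hf) (Submodule.zero_mem _) ?_ ?_ u
    · intro c i e he
      have : c • (Dd m ι g θ i * e) = (⟨c • Dd m ι g θ i, A.smul_mem (hDA i) c⟩ : A) • e :=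
        (smul_mul_assoc c _ e).symm
      rw [this]
      exact Submodule.smul_mem _ _ he
    · rintro e ⟨β, hβ, β', he⟩
      obtain ⟨z, hz0, hz⟩ := hdiv β hβ
      refine ⟨⟨jj m ι (β * z), hjA _ hz⟩, ?_, ?_⟩
      · intro h
        exact jj_ne W hz0 (congrArg Subtype.val h)
      · have : (⟨jj m ι (β * z), hjA _ hz⟩ : A) • e = jj m ι (z * β') := by
          change jj m ι (β * z) * e = _
          rw [mul_comm, jj_mul, jj_mul, mul_assoc, he]
        rw [this]
        exact hjspan _
  have hall := all_in (K := K) (ι : R →+* E) W.hi hfrac A hgen hZ hW ho _ hS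
  let _ : Module L E :=
    { smul := fun l e => e * gl l
      one_smul := fun e => by change e * gl 1 = e; simp
      mul_smul := fun l l' e => by
        change e * gl (l * l') = e * gl l' * gl l
        rw [mul_comm, map_mul, mul_assoc]
      smul_zero := fun l => zero_mul _
      smul_add := fun l e f => add_mul _ _ _
      add_smul := fun l l' e => by
        change e * gl (l + l') = e * gl l + e * gl l'
        rw [map_add, mul_add]
      zero_smul := fun e => by change e * gl 0 = 0; simp }
  have : IsScalarTower K L E := ⟨fun c l e => by
    change e * gl (c • l) = c • (e * gl l)
    rw [map_smul, mul_smul_comm]⟩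
  have : SMulCommClass A L E := ⟨fun a l e => by
    change a.1 * (e * gl l) = (a.1 * e) * gl l
    rw [mul_assoc]⟩
  refine core (K := K) (A := A) (V := E) (Z := ZA) hgen hZ hW ?_ t ?_ (L := L) hn (by omega) x hx
  · intro a v h
    rcases mul_eq_zero.1 (show a.1 * v = 0 from h) with h | h
    · exact Or.inl (Subtype.ext h)
    · exact Or.inr h
  · intro r v hv
    exact rank_clos (K := K) hgen hZ hW _ v hv ho (fun j => hall _)
end fin
end

section
section conc
variable {K B : Type} [Field K] [CommRing B] [Algebra K B]

lemma mu_mem (b : B) : mu K b ∈ diffOps K B := (mem_diffOps_iff _).2 ⟨0, mem_D0.2 ⟨b, rfl⟩⟩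

/-- the embedding of `B` into differential operators -/
def mR (K B : Type) [Field K] [CommRing B] [Algebra K B] : B →ₐ[K] diffOps K B :=
  (Algebra.lmul K B).codRestrict (diffOps K B) (fun b => mu_mem b)

/-- derivations as differential operators -/
def tR (θ : Derivation K B B) : diffOps K B :=
  ⟨(θ : B →ₗ[K] B), (mem_diffOps_iff _).2 ⟨1, deriv_mem θ⟩⟩

lemma mR_ap (b x : B) : (mR K B b).1 x = b * x := rfl
lemma tR_ap (θ : Derivation K B B) (x : B) : (tR θ).1 x = θ x := rfl
lemma dext {u v : diffOps K B} (h : ∀ x, u.1 x = v.1 x) : u = v := Subtype.ext (LinearMap.ext h)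

lemma nil_aux (z : B) (c : ℕ) : ∀ u : diffOps K B, u.1 ∈ diffOpsLE K B c →
    (fun v => v * mR K B z - mR K B z * v)^[c + 1] u = 0 := by
  induction c with
  | zero =>
    rintro u ⟨b, hb⟩
    apply dext
    intro x
    have h : ∀ x, u.1 x = b * x := fun x => by rw [← hb]; rfl
    change u.1 (z * x) - z * u.1 x = 0
    rw [h, h]; ring
  | succ c ih =>
    intro u hu
    rw [Function.iterate_succ_apply]
    exact ih _ (mem_Dsucc.1 hu z)

lemma comm_D0 {n : ℕ} (y : Fin n → B)
    (hder : ∀ θ : Derivation K B B, (∀ i, θ (y i) = 0) → θ = 0) (u : diffOps K B)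
    (h : ∀ k, u * mR K B (y k) = mR K B (y k) * u) : ∃ b, u = mR K B b := by
  obtain ⟨c, hc⟩ := (mem_diffOps_iff _).1 u.2
  obtain ⟨b, hb⟩ := V1 y hder c u.1 hc (fun i => congrArg Subtype.val (h i))
  exact ⟨b, Subtype.ext hb.symm⟩

lemma omega_zero {n : ℕ} (y : Fin n → B) (g : B) (θ : Fin n → Derivation K B B)
    (hT : ∀ i j, θ i (y j) = if i = j then g else 0)
    (hder : ∀ θ : Derivation K B B, (∀ i, θ (y i) = 0) → θ = 0) (i j : Fin n) :
    mR K B g * tR (θ i) * tR (θ j) - mR K B (θ i g) * tR (θ j) =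
      mR K B g * tR (θ j) * tR (θ i) - mR K B (θ j g) * tR (θ i) := by
  rw [← sub_eq_zero]
  set w := mR K B g * tR (θ i) * tR (θ j) - mR K B (θ i g) * tR (θ j) -
      (mR K B g * tR (θ j) * tR (θ i) - mR K B (θ j g) * tR (θ i)) with hw
  have hwx : ∀ x, w.1 x = g * θ i (θ j x) - θ i g * θ j x - (g * θ j (θ i x) - θ j g * θ i x) :=
    fun x => rfl
  obtain ⟨b, hb⟩ := comm_D0 y hder w (by
    intro k
    apply dext
    intro x
    change w.1 (y k * x) = y k * w.1 x
    rw [hwx, hwx]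
    have hi : g * θ i (θ j (y k)) = θ i g * θ j (y k) := by
      rw [hT]; split_ifs <;> simp [mul_comm]
    have hj : g * θ j (θ i (y k)) = θ j g * θ i (y k) := by
      rw [hT]; split_ifs <;> simp [mul_comm]
    simp only [Derivation.leibniz, map_add, smul_eq_mul]
    linear_combination x * hi - x * hj)
  have h1 : b = 0 := by
    have e := congrArg (fun u : diffOps K B => u.1 1) hb
    simp only [hwx, mR_ap] at e
    simpa using e.symm
  rw [hb, h1, map_zero]

theorem conc_main (K B : Type) [Field K] [CharZero K]
    [CommRing B] [Algebra K B] [IsDomain B] [Algebra.Smooth K B]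
    (n : ℕ) (hn : 0 < n) (hdim : ringKrullDim B = (n : WithBot (WithTop ℕ)))
    (E : Type) [DivisionRing E]
    (ι : ↥(diffOps K B) →+* E) (hι : Function.Injective ι)
    (hfrac : ∀ x : E, ∃ s a : ↥(diffOps K B), s ≠ 0 ∧ ι s * x = ι a)
    (L : Type) [Field L] (g : L →+* E) [Algebra K L]
    (hres : ∀ c : K, g (algebraMap K L c) = ι (algebraMap K ↥(diffOps K B) c))
    (m : ℕ) (x : Fin m → L) (hx : AlgebraicIndependent K x) : m ≤ n := by
  have : Algebra.FiniteType K B := inferInstance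
  obtain ⟨s, hs0, hsn, y, t, b, γ, θ, hγ, hT, hgenB, hdiv, hder⟩ := geom K B n hn hdim
  refine le_trans ?_ hsn
  let al : Algebra K E := RingHom.toAlgebra' (ι.comp (algebraMap K (diffOps K B))) (by
    intro c x
    obtain ⟨s, a, hs, h⟩ := hfrac x
    have hs' : ι s ≠ 0 := fun h => hs (hι (h.trans (map_zero ι).symm))
    apply mul_left_cancel₀ hs'
    simp only [RingHom.comp_apply]
    rw [← mul_assoc, ← map_mul, ← Algebra.commutes, map_mul, mul_assoc, h, ← mul_assoc, h,
      ← map_mul, ← map_mul, Algebra.commutes])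
  let ι' : diffOps K B →ₐ[K] E := { ι with commutes' := fun c => rfl }
  let gl : L →ₐ[K] E := { g with commutes' := hres }
  have W : WS (mR K B) ι' y γ (fun i b => θ i b) (fun i => tR (θ i)) :=
    { hm := by
        intro a b h
        have := congrArg (fun u : diffOps K B => u.1 1) h
        simpa [mR_ap] using this
      hi := hι
      hg := hγ
      hθ := by
        intro i b
        apply dext
        intro x
        change θ i (b * x) = b * θ i x + θ i b * x
        simp [mul_comm]
      hT := hT
      hω := omega_zero y γ θ hT hder
      nil := by
        intro u k
        obtain ⟨c, hc⟩ := (mem_diffOps_iff _).1 u.2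
        exact ⟨c + 1, nil_aux _ c u hc⟩
      v1 := comm_D0 y hder }
  exact abstract_main W hs0 hfrac b hgenB hdiv gl x hx
end conc
end

/-- Let `K` be an algebraically closed field of characteristic zero, `X` a smooth
irreducible affine algebraic variety of dimension `n > 0` with coordinate ring `B = O(X)`
(a smooth finitely generated commutative domain of Krull dimension `n`), `D(X) = D(B)`
its ring of differential operators, and let `E` be the quotient division ring
`Frac D(X)` (i.e. a division ring with an embedding `ι : D(X) → E` such that every
element of `E` is a left fraction `ι(s)⁻¹ ι(a)`). Then every commutative subfield `L` of
`E` containing `K` (presented as a field `L` with an embedding `g : L → E` restricting to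
the canonical embedding on `K`) has transcendence degree at most `n` over `K`: every
`K`-algebraically independent family in `L` has at most `n` elements. -/
theorem trdeg_subfield_of_fraction_diffOps_le
    (K B : Type) [Field K] [IsAlgClosed K] [CharZero K]
    [CommRing B] [Algebra K B] [IsDomain B] [Algebra.Smooth K B]
    (n : ℕ) (hn : 0 < n) (hdim : ringKrullDim B = (n : WithBot (WithTop ℕ)))
    (E : Type) [DivisionRing E]
    (ι : ↥(diffOps K B) →+* E) (hι : Function.Injective ι)
    (hfrac : ∀ x : E, ∃ s a : ↥(diffOps K B), s ≠ 0 ∧ ι s * x = ι a)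
    (L : Type) [Field L] (g : L →+* E) (hg : Function.Injective g) (ρ : K →+* L)
    (hres : ∀ c : K, g (ρ c) = ι (algebraMap K ↥(diffOps K B) c)) :
    letI : Algebra K L := ρ.toAlgebra
    ∀ (m : ℕ) (x : Fin m → L), AlgebraicIndependent K x → m ≤ n := by
  intro m x hx
  let _ : Algebra K L := ρ.toAlgebra
  exact conc_main K B n hn hdim E ι hι hfrac L g hres m x hx

end
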